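/- arXiv:2509.17151 — 8 statements merged into one kernel-verified Lean document; each statement's English description precedes it below -/
import Mathlib

section
/- Let γ ∈ (0,∞) and define α(ξ) = (γ + i(⟨ξ⟩ + ξ))/(1 + iγ(⟨ξ⟩ + ξ)) for ξ ∈ ℝ. Then α is differentiable on ℝ and there exists a constant C(γ) > 0 such that for all ξ ∈ ℝ, |α'(ξ)| ≤ C(γ)·⟨ξ⟩⁻². -/
noncomputable section

open Complex

/-- The Japanese bracket `⟨ξ⟩ = √(ξ² + 1)`. -/
def jap (ξ : ℝ) : ℝ := Real.sqrt (ξ ^ 2 + 1)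

/-- The boundary coefficient `α(ξ) = (γ + i(⟨ξ⟩ + ξ)) / (1 + iγ(⟨ξ⟩ + ξ))`. -/
def alphaFun (γ ξ : ℝ) : ℂ :=
  ((γ : ℂ) + Complex.I * ((jap ξ + ξ : ℝ) : ℂ)) /
    (1 + Complex.I * (γ : ℂ) * ((jap ξ + ξ : ℝ) : ℂ))

lemma jap_sq (ξ : ℝ) : jap ξ ^ 2 = ξ ^ 2 + 1 :=
  Real.sq_sqrt (by positivity)

lemma jap_pos (ξ : ℝ) : 0 < jap ξ :=
  Real.sqrt_pos.2 (by positivity)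

lemma jap_add_self_pos (ξ : ℝ) : 0 < jap ξ + ξ := by
  nlinarith [jap_sq ξ, jap_pos ξ]

lemma two_mul_jap_mul_jap_add_self (ξ : ℝ) :
    2 * (jap ξ * (jap ξ + ξ)) = (jap ξ + ξ) ^ 2 + 1 := by
  linear_combination jap_sq ξ

lemma hasDerivAt_jap_add_self (ξ : ℝ) :
    HasDerivAt (fun x ↦ jap x + x) ((jap ξ + ξ) / jap ξ) ξ := by
  have h : HasDerivAt (fun x : ℝ ↦ x ^ 2 + 1) (2 * ξ) ξ := by
    simpa using (hasDerivAt_pow 2 ξ).add_const 1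
  have h' := (h.sqrt (by positivity)).add (hasDerivAt_id ξ)
  refine h'.congr_deriv ?_
  change 2 * ξ / (2 * jap ξ) + 1 = _
  have := (jap_pos ξ).ne'
  field_simp
  ring

lemma norm_one_add_I_mul_sq (t : ℝ) : ‖1 + I * (t : ℂ)‖ ^ 2 = 1 + t ^ 2 := by
  rw [← Complex.normSq_eq_norm_sq, Complex.normSq_apply]
  simp
  ring

lemma one_add_I_mul_ne_zero (t : ℝ) : 1 + I * (t : ℂ) ≠ 0 := by
  intro h
  simpa using congrArg Complex.re h

lemma hasDerivAt_alphaFun (γ ξ : ℝ) :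
    HasDerivAt (alphaFun γ)
      (I * ((1 - γ ^ 2 : ℝ) : ℂ) * (((jap ξ + ξ) / jap ξ : ℝ) : ℂ) /
        (1 + I * ((γ * (jap ξ + ξ) : ℝ) : ℂ)) ^ 2) ξ := by
  have hs := (hasDerivAt_jap_add_self ξ).ofReal_comp
  have hne : 1 + I * (γ : ℂ) * ((jap ξ + ξ : ℝ) : ℂ) ≠ 0 := by
    simpa [mul_assoc] using one_add_I_mul_ne_zero (γ * (jap ξ + ξ))
  refine (((hs.const_mul I).const_add (γ : ℂ)).div
    ((hs.const_mul (I * (γ : ℂ))).const_add 1) hne).congr_deriv ?_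
  rw [Complex.ofReal_mul, ← mul_assoc I]
  congr 1
  push_cast
  ring

lemma norm_deriv_alphaFun (γ ξ : ℝ) :
    ‖deriv (alphaFun γ) ξ‖ =
      |1 - γ ^ 2| * ((jap ξ + ξ) / jap ξ) / (1 + (γ * (jap ξ + ξ)) ^ 2) := by
  have h : 0 < (jap ξ + ξ) / jap ξ := div_pos (jap_add_self_pos ξ) (jap_pos ξ)
  rw [(hasDerivAt_alphaFun γ ξ).deriv, norm_div, norm_pow, norm_one_add_I_mul_sq, norm_mul,
    norm_mul, Complex.norm_I, one_mul, Complex.norm_real, Complex.norm_real, Real.norm_eq_abs,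
    Real.norm_eq_abs, abs_of_pos h]

theorem stmt2 (γ : ℝ) (hγ : 0 < γ) :
    Differentiable ℝ (alphaFun γ) ∧
      ∃ C > 0, ∀ ξ : ℝ, ‖deriv (alphaFun γ) ξ‖ ≤ C * ((jap ξ) ^ 2)⁻¹ := by
  refine ⟨fun ξ ↦ (hasDerivAt_alphaFun γ ξ).differentiableAt,
    (|1 - γ ^ 2| + 1) * (1 + (γ ^ 2)⁻¹), by positivity, fun ξ ↦ ?_⟩
  have hJ := jap_pos ξ
  have hs := jap_add_self_pos ξ
  have hJs := two_mul_jap_mul_jap_add_self ξ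
  rw [norm_deriv_alphaFun]
  set J := jap ξ
  set s := J + ξ
  have hD : 0 < 1 + (γ * s) ^ 2 := by positivity
  have key : J * s ≤ (1 + (γ ^ 2)⁻¹) * (1 + (γ * s) ^ 2) := by
    have h : (1 + (γ ^ 2)⁻¹) * (1 + (γ * s) ^ 2) =
        1 + (γ ^ 2)⁻¹ + (γ * s) ^ 2 + s ^ 2 := by
      field_simp
      ring
    have hγi : 0 < (γ ^ 2)⁻¹ := by positivity
    nlinarith [sq_nonneg (γ * s), sq_nonneg s]
  calc |1 - γ ^ 2| * (s / J) / (1 + (γ * s) ^ 2)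
      = |1 - γ ^ 2| * (J * s / (1 + (γ * s) ^ 2)) * (J ^ 2)⁻¹ := by
        field_simp
    _ ≤ (|1 - γ ^ 2| + 1) * (1 + (γ ^ 2)⁻¹) * (J ^ 2)⁻¹ := by
        gcongr
        · linarith
        · exact (div_le_iff₀ hD).2 key
end
end

section
/- Fix ξ ∈ ℝ and let K^ℝ_{0,ξ} : ℝ → M₂(ℂ) be the matrix-valued function K^ℝ_{0,ξ}(z) = (1/(2⟨ξ⟩)) e^{−⟨ξ⟩|z|} [[i, ξ + ⟨ξ⟩·sign(z)], [ξ − ⟨ξ⟩·sign(z), i]]. Then for every smooth compactly supported Ψ = (Ψ₁, Ψ₂) : ℝ → ℂ², the convolution Φ(t) = ∫_ℝ K^ℝ_{0,ξ}(t − t') Ψ(t') dt' defines a smooth function Φ = (Φ₁, Φ₂) : ℝ → ℂ² satisfying, for all t ∈ ℝ: ξΦ₂(t) − Φ₂'(t) − iΦ₁(t) = Ψ₁(t) and ξΦ₁(t) + Φ₁'(t) − iΦ₂(t) = Ψ₂(t). -/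
noncomputable section

open Complex MeasureTheory

/-- The whole-line resolvent kernel `K^ℝ_{0,ξ}(z)` of the free Dirac fiber operator. -/
def KR (ξ z : ℝ) : Matrix (Fin 2) (Fin 2) ℂ :=
  (((2 * jap ξ)⁻¹ * Real.exp (-(jap ξ * |z|)) : ℝ) : ℂ) •
    !![Complex.I, ((ξ + jap ξ * Real.sign z : ℝ) : ℂ);
       ((ξ - jap ξ * Real.sign z : ℝ) : ℂ), Complex.I]

/-- The forward primitive `t ↦ e^{-Jt} ∫_{s ≤ t} e^{Js} ψ(s) ds`. -/
def expForward (J : ℝ) (ψ : ℝ → ℂ) (t : ℝ) : ℂ :=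
  cexp (-(J * t : ℝ)) * ∫ s in Set.Iic t, cexp (J * s : ℝ) * ψ s

/-- The backward primitive `t ↦ e^{Jt} ∫_{s > t} e^{-Js} ψ(s) ds`. -/
def expBackward (J : ℝ) (ψ : ℝ → ℂ) (t : ℝ) : ℂ :=
  cexp (J * t : ℝ) * ∫ s in Set.Ioi t, cexp (-(J * s : ℝ)) * ψ s

lemma hasDerivAt_integral_Iic {f : ℝ → ℂ} (hf : Continuous f) (hi : Integrable f) (t : ℝ) :
    HasDerivAt (fun t => ∫ s in Set.Iic t, f s) (f t) t := by
  have h : (fun t => ∫ s in Set.Iic t, f s) =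
      fun t => (∫ s in (0 : ℝ)..t, f s) + ∫ s in Set.Iic 0, f s := by
    funext t
    rw [← intervalIntegral.integral_Iic_sub_Iic hi.integrableOn hi.integrableOn]
    ring
  rw [h]
  exact (hf.integral_hasStrictDerivAt 0 t).hasDerivAt.add_const _

lemma hasDerivAt_integral_Ioi {f : ℝ → ℂ} (hf : Continuous f) (hi : Integrable f) (t : ℝ) :
    HasDerivAt (fun t => ∫ s in Set.Ioi t, f s) (-f t) t := by
  have h : (fun t => ∫ s in Set.Ioi t, f s) =
      fun t => (∫ s, f s) - ∫ s in Set.Iic t, f s := by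
    funext t
    rw [← intervalIntegral.integral_Iic_add_Ioi (b := t) hi.integrableOn hi.integrableOn]
    ring
  rw [h]
  exact (hasDerivAt_integral_Iic hf hi t).const_sub _

lemma hasDerivAt_cexp_mul (c t : ℝ) :
    HasDerivAt (fun t : ℝ => cexp (c * t : ℝ)) (c * cexp (c * t : ℝ)) t := by
  have h := (((hasDerivAt_id t).const_mul c).ofReal_comp).cexp
  simpa [mul_comm] using h

lemma contDiff_cexp_mul (c : ℝ) : ContDiff ℝ (⊤ : ℕ∞) (fun t : ℝ => cexp (c * t : ℝ)) :=
  (ofRealCLM.contDiff.comp (contDiff_const.mul contDiff_id)).cexp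

lemma integrable_cexp_mul (c : ℝ) {ψ : ℝ → ℂ} (hψ : Continuous ψ) (hs : HasCompactSupport ψ) :
    Integrable (fun s : ℝ => cexp (c * s : ℝ) * ψ s) :=
  ((contDiff_cexp_mul c).continuous.mul hψ).integrable_of_hasCompactSupport hs.mul_left

lemma contDiff_of_hasDerivAt {f f' : ℝ → ℂ} (h : ∀ t, HasDerivAt f (f' t) t)
    (hf' : ContDiff ℝ (⊤ : ℕ∞) f') : ContDiff ℝ (⊤ : ℕ∞) f := by
  rw [contDiff_infty_iff_deriv]
  refine ⟨fun t => (h t).differentiableAt, ?_⟩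
  rwa [show deriv f = f' from funext fun t => (h t).deriv]

section Primitives

variable (J : ℝ) {ψ : ℝ → ℂ}

lemma hasDerivAt_expForward (hψ : Continuous ψ) (hs : HasCompactSupport ψ) (t : ℝ) :
    HasDerivAt (expForward J ψ) (-J * expForward J ψ t + ψ t) t := by
  have h₁ := hasDerivAt_cexp_mul (-J) t
  have h₂ := hasDerivAt_integral_Iic ((contDiff_cexp_mul J).continuous.mul hψ)
    (integrable_cexp_mul J hψ hs) t
  have h := h₁.mul h₂
  simp only [neg_mul, ofReal_neg, Pi.mul_apply] at h
  refine h.congr_deriv ?_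
  have e : cexp (-(J * t : ℝ)) * cexp (J * t : ℝ) = 1 := by rw [← Complex.exp_add]; simp
  simp only [expForward]
  linear_combination ψ t * e

lemma hasDerivAt_expBackward (hψ : Continuous ψ) (hs : HasCompactSupport ψ) (t : ℝ) :
    HasDerivAt (expBackward J ψ) (J * expBackward J ψ t - ψ t) t := by
  have h₁ := hasDerivAt_cexp_mul J t
  have h₂ := hasDerivAt_integral_Ioi ((contDiff_cexp_mul (-J)).continuous.mul hψ)
    (integrable_cexp_mul (-J) hψ hs) t
  have h := h₁.mul h₂
  simp only [neg_mul, ofReal_neg, Pi.mul_apply] at h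
  refine h.congr_deriv ?_
  have e : cexp (-(J * t : ℝ)) * cexp (J * t : ℝ) = 1 := by rw [← Complex.exp_add]; simp
  simp only [expBackward]
  linear_combination -ψ t * e

lemma contDiff_expForward (hψ : ContDiff ℝ (⊤ : ℕ∞) ψ) (hs : HasCompactSupport ψ) :
    ContDiff ℝ (⊤ : ℕ∞) (expForward J ψ) := by
  have h := (contDiff_cexp_mul (-J)).mul (contDiff_of_hasDerivAt
    (hasDerivAt_integral_Iic ((contDiff_cexp_mul J).continuous.mul hψ.continuous)
      (integrable_cexp_mul J hψ.continuous hs)) ((contDiff_cexp_mul J).mul hψ))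
  simp only [neg_mul, ofReal_neg, Pi.mul_apply] at h
  exact h

lemma contDiff_expBackward (hψ : ContDiff ℝ (⊤ : ℕ∞) ψ) (hs : HasCompactSupport ψ) :
    ContDiff ℝ (⊤ : ℕ∞) (expBackward J ψ) := by
  have h := (contDiff_cexp_mul J).mul (contDiff_of_hasDerivAt
    (hasDerivAt_integral_Ioi ((contDiff_cexp_mul (-J)).continuous.mul hψ.continuous)
      (integrable_cexp_mul (-J) hψ.continuous hs)) ((contDiff_cexp_mul (-J)).mul hψ).neg)
  simp only [neg_mul, ofReal_neg, Pi.mul_apply] at h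
  exact h

/-- Convolution with a kernel that is a multiple of `e^{-Jz}` for `z > 0` and of `e^{Jz}` for
`z < 0`, with no condition at `z = 0`. -/
lemma integrable_and_integral_exp_kernel (hψ : Continuous ψ) (hs : HasCompactSupport ψ)
    {k : ℝ → ℂ} {c d : ℂ} (hpos : ∀ z, 0 < z → k z = c * cexp (-(J * z : ℝ)))
    (hneg : ∀ z, z < 0 → k z = d * cexp (J * z : ℝ)) (t : ℝ) :
    Integrable (fun s => k (t - s) * ψ s) ∧
      ∫ s, k (t - s) * ψ s = c * expForward J ψ t + d * expBackward J ψ t := by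
  have hl : Set.EqOn (fun s => c * cexp (-(J * t : ℝ)) * (cexp (J * s : ℝ) * ψ s))
      (fun s => k (t - s) * ψ s) (Set.Iio t) := by
    intro s hst
    simp only
    rw [hpos _ (sub_pos.2 hst), show (-(J * (t - s) : ℝ) : ℂ) = -(J * t : ℝ) + (J * s : ℝ) by
      push_cast; ring, Complex.exp_add]
    ring
  have hr : Set.EqOn (fun s => d * cexp (J * t : ℝ) * (cexp (-(J * s : ℝ)) * ψ s))
      (fun s => k (t - s) * ψ s) (Set.Ioi t) := by
    intro s hst
    simp only
    rw [hneg _ (sub_neg.2 hst), show ((J * (t - s) : ℝ) : ℂ) = (J * t : ℝ) + -(J * s : ℝ) by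
      push_cast; ring, Complex.exp_add]
    ring
  have il : IntegrableOn (fun s => k (t - s) * ψ s) (Set.Iic t) := by
    rw [integrableOn_Iic_iff_integrableOn_Iio]
    exact (((integrable_cexp_mul J hψ hs).const_mul _).integrableOn).congr_fun hl measurableSet_Iio
  have ir : IntegrableOn (fun s => k (t - s) * ψ s) (Set.Ioi t) := by
    have h := integrable_cexp_mul (-J) hψ hs
    simp only [neg_mul, ofReal_neg] at h
    exact ((h.const_mul _).integrableOn).congr_fun hr measurableSet_Ioi
  refine ⟨?_, ?_⟩
  · rw [← integrableOn_univ, ← Set.Iic_union_Ioi (a := t)]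
    exact il.union ir
  · rw [← intervalIntegral.integral_Iic_add_Ioi il ir, integral_Iic_eq_integral_Iio,
      ← setIntegral_congr_fun measurableSet_Iio hl, ← setIntegral_congr_fun measurableSet_Ioi hr,
      integral_const_mul, integral_const_mul, expForward, expBackward,
      integral_Iic_eq_integral_Iio]
    ring

end Primitives

lemma KR_of_pos (ξ : ℝ) {z : ℝ} (hz : 0 < z) (i j : Fin 2) :
    KR ξ z i j = ((2 * jap ξ : ℂ)⁻¹ * !![I, ξ + jap ξ; ξ - jap ξ, I] i j) *
      cexp (-(jap ξ * z : ℝ)) := by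
  fin_cases i <;> fin_cases j <;> simp [KR, abs_of_pos hz, Real.sign_of_pos hz] <;> ring

lemma KR_of_neg (ξ : ℝ) {z : ℝ} (hz : z < 0) (i j : Fin 2) :
    KR ξ z i j = ((2 * jap ξ : ℂ)⁻¹ * !![I, ξ - jap ξ; ξ + jap ξ, I] i j) *
      cexp (jap ξ * z : ℝ) := by
  fin_cases i <;> fin_cases j <;> simp [KR, abs_of_neg hz, Real.sign_of_neg hz] <;> ring

lemma integral_KR_mulVec_apply (ξ : ℝ) {Ψ : ℝ → Fin 2 → ℂ}
    (hΨ : ∀ j, Continuous fun t => Ψ t j) (hs : ∀ j, HasCompactSupport fun t => Ψ t j)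
    (t : ℝ) (i : Fin 2) :
    (∫ s, (KR ξ (t - s)).mulVec (Ψ s)) i = ∑ j,
      ((2 * jap ξ : ℂ)⁻¹ * !![I, ξ + jap ξ; ξ - jap ξ, I] i j *
          expForward (jap ξ) (fun s => Ψ s j) t +
        (2 * jap ξ : ℂ)⁻¹ * !![I, ξ - jap ξ; ξ + jap ξ, I] i j *
          expBackward (jap ξ) (fun s => Ψ s j) t) := by
  have H := fun i j => integrable_and_integral_exp_kernel (jap ξ) (hΨ j) (hs j)
    (k := fun z => KR ξ z i j) (fun z hz => KR_of_pos ξ hz i j)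
    (fun z hz => KR_of_neg ξ hz i j) t
  rw [eval_integral]
  · simp only [Matrix.mulVec, dotProduct]
    rw [integral_finsetSum _ fun j _ => (H i j).1]
    exact Finset.sum_congr rfl fun j _ => (H i j).2
  · intro i
    simp only [Matrix.mulVec, dotProduct]
    exact integrable_finsetSum _ fun j _ => (H i j).1

theorem stmt3 (ξ : ℝ) (Ψ : ℝ → Fin 2 → ℂ)
    (hΨ : ContDiff ℝ (⊤ : ℕ∞) Ψ) (hsupp : HasCompactSupport Ψ)
    (Φ : ℝ → Fin 2 → ℂ)
    (hΦ : ∀ t : ℝ, Φ t = ∫ t' : ℝ, (KR ξ (t - t')).mulVec (Ψ t')) :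
    ContDiff ℝ (⊤ : ℕ∞) Φ ∧
      ∀ t : ℝ,
        (ξ : ℂ) * Φ t 1 - deriv (fun s => Φ s 1) t - Complex.I * Φ t 0 = Ψ t 0 ∧
        (ξ : ℂ) * Φ t 0 + deriv (fun s => Φ s 0) t - Complex.I * Φ t 1 = Ψ t 1 := by
  have hψ : ∀ j, ContDiff ℝ (⊤ : ℕ∞) fun t => Ψ t j := contDiff_pi.1 hΨ
  have hs : ∀ j, HasCompactSupport fun t => Ψ t j := fun j =>
    hsupp.comp_left (g := fun v : Fin 2 → ℂ => v j) rfl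
  have hΦi := fun t i => (congrFun (hΦ t) i).trans
    (integral_KR_mulVec_apply ξ (fun j => (hψ j).continuous) hs t i)
  have hJ : (jap ξ : ℂ) ≠ 0 := by
    exact_mod_cast (Real.sqrt_pos.2 (by positivity : 0 < ξ ^ 2 + 1)).ne'
  have hJ2 : (jap ξ : ℂ) ^ 2 = ξ ^ 2 + 1 := by
    exact_mod_cast Real.sq_sqrt (by positivity : 0 ≤ ξ ^ 2 + 1)
  refine ⟨contDiff_pi.2 fun i => ?_, fun t => ?_⟩
  · simp only [hΦi]
    exact ContDiff.sum fun j _ =>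
      (contDiff_const.mul (contDiff_expForward _ (hψ j) (hs j))).add
        (contDiff_const.mul (contDiff_expBackward _ (hψ j) (hs j)))
  · have hd := fun i => (HasDerivAt.fun_sum (u := Finset.univ) fun j _ =>
      ((hasDerivAt_expForward (jap ξ) (hψ j).continuous (hs j) t).const_mul
        ((2 * jap ξ : ℂ)⁻¹ * !![I, (ξ : ℂ) + jap ξ; ξ - jap ξ, I] i j)).fun_add
      ((hasDerivAt_expBackward (jap ξ) (hψ j).continuous (hs j) t).const_mul
        ((2 * jap ξ : ℂ)⁻¹ * !![I, (ξ : ℂ) - jap ξ; ξ + jap ξ, I] i j))).deriv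
    simp only [hΦi, hd]
    simp only [Fin.sum_univ_two, Matrix.of_apply, Matrix.cons_val', Matrix.cons_val_zero,
      Matrix.cons_val_one, Matrix.cons_val_fin_one]
    generalize expForward (jap ξ) (fun s => Ψ s 0) t = U₀
    generalize expForward (jap ξ) (fun s => Ψ s 1) t = U₁
    generalize expBackward (jap ξ) (fun s => Ψ s 0) t = V₀
    generalize expBackward (jap ξ) (fun s => Ψ s 1) t = V₁
    generalize (jap ξ : ℂ) = J at hJ hJ2 ⊢
    constructor
    · field_simp
      linear_combination (-(U₀ + V₀)) * hJ2 - (U₀ + V₀) * I_sq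
    · field_simp
      linear_combination (-(U₁ + V₁)) * hJ2 - (U₁ + V₁) * I_sq
end
end

section
/- Fix ξ ∈ ℝ. A differentiable function u = (u₁, u₂) : (0,∞) → ℂ² satisfies the system ξu₂(t) − u₂'(t) − i u₁(t) = 0 and ξu₁(t) + u₁'(t) − i u₂(t) = 0 for all t > 0 if and only if there exist constants α, β ∈ ℂ such that for all t > 0: u₁(t) = i(⟨ξ⟩ − ξ)·α·e^{⟨ξ⟩t} − i(⟨ξ⟩ + ξ)·β·e^{−⟨ξ⟩t} and u₂(t) = α·e^{⟨ξ⟩t} + β·e^{−⟨ξ⟩t}. -/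
noncomputable section

open Complex

lemma hasDerivAt_cexp_const_mul (c : ℂ) (t : ℝ) :
    HasDerivAt (fun s : ℝ => exp (c * s)) (c * exp (c * t)) t := by
  have h : HasDerivAt (fun s : ℝ => c * (s : ℂ)) c t := by
    simpa using (ofRealCLM.hasDerivAt (x := t)).const_mul c
  simpa [mul_comm] using h.cexp

/-- On a connected open set, the solutions of `f' = c f` are the multiples of `exp (c t)`. -/
lemma exists_eq_mul_cexp_of_hasDerivAt {s : Set ℝ} (hs : IsOpen s) (hs' : IsPreconnected s)
    {f : ℝ → ℂ} {c : ℂ} (hf : ∀ t ∈ s, HasDerivAt f (c * f t) t) :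
    ∃ a : ℂ, ∀ t ∈ s, f t = a * exp (c * t) := by
  have hg : ∀ t ∈ s, HasDerivAt (fun r : ℝ => f r * exp (-c * r)) 0 t := fun t ht =>
    ((hf t ht).mul (hasDerivAt_cexp_const_mul (-c) t)).congr_deriv (by ring)
  obtain ⟨a, ha⟩ := hs.exists_is_const_of_deriv_eq_zero hs'
    (fun t ht => (hg t ht).differentiableAt.differentiableWithinAt) (fun t ht => (hg t ht).deriv)
  refine ⟨a, fun t ht => ?_⟩
  rw [← ha t ht, mul_assoc, ← exp_add]
  simp

theorem stmt5 (ξ : ℝ) (u : ℝ → Fin 2 → ℂ)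
    (hu : ∀ t ∈ Set.Ioi (0 : ℝ),
      DifferentiableAt ℝ (fun s => u s 0) t ∧ DifferentiableAt ℝ (fun s => u s 1) t) :
    (∀ t : ℝ, 0 < t →
        (ξ : ℂ) * u t 1 - deriv (fun s => u s 1) t - Complex.I * u t 0 = 0 ∧
        (ξ : ℂ) * u t 0 + deriv (fun s => u s 0) t - Complex.I * u t 1 = 0)
      ↔ ∃ a b : ℂ, ∀ t : ℝ, 0 < t →
          u t 0 = Complex.I * ((jap ξ - ξ : ℝ) : ℂ) * a * Complex.exp ((jap ξ : ℂ) * t)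
              - Complex.I * ((jap ξ + ξ : ℝ) : ℂ) * b * Complex.exp (-((jap ξ : ℂ) * t)) ∧
          u t 1 = a * Complex.exp ((jap ξ : ℂ) * t) + b * Complex.exp (-((jap ξ : ℂ) * t)) := by
  have hJ : (jap ξ : ℂ) ≠ 0 := ofReal_ne_zero.2 (jap_pos ξ).ne'
  have hsq : (jap ξ : ℂ) ^ 2 = (ξ : ℂ) ^ 2 + 1 := by exact_mod_cast jap_sq ξ
  simp only [← neg_mul, ofReal_sub, ofReal_add]
  generalize (jap ξ : ℂ) = J at hJ hsq ⊢
  constructor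
  · intro h
    have h0 : ∀ t ∈ Set.Ioi (0 : ℝ),
        HasDerivAt (fun s => u s 0) (I * u t 1 - ξ * u t 0) t := fun t ht =>
      (hu t ht).1.hasDerivAt.congr_deriv (by linear_combination (h t ht).2)
    have h1 : ∀ t ∈ Set.Ioi (0 : ℝ),
        HasDerivAt (fun s => u s 1) (ξ * u t 1 - I * u t 0) t := fun t ht =>
      (hu t ht).2.hasDerivAt.congr_deriv (by linear_combination -(h t ht).1)
    -- The two combinations of `u₁` and `u₂` that diagonalize the system.
    obtain ⟨a, ha⟩ := exists_eq_mul_cexp_of_hasDerivAt isOpen_Ioi isPreconnected_Ioi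
      (f := fun s => (J + ξ) * u s 1 - I * u s 0) (c := J) fun t ht =>
        (((h1 t ht).const_mul (J + ξ : ℂ)).sub ((h0 t ht).const_mul I)).congr_deriv (by
          linear_combination -u t 1 * hsq - u t 1 * I_sq)
    obtain ⟨b, hb⟩ := exists_eq_mul_cexp_of_hasDerivAt isOpen_Ioi isPreconnected_Ioi
      (f := fun s => (J - ξ) * u s 1 + I * u s 0) (c := -J) fun t ht =>
        (((h1 t ht).const_mul (J - ξ : ℂ)).add ((h0 t ht).const_mul I)).congr_deriv (by
          linear_combination u t 1 * hsq + u t 1 * I_sq)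
    refine ⟨a / (2 * J), b / (2 * J), fun t ht => ?_⟩
    have hat := ha t ht
    have hbt := hb t ht
    rw [neg_mul] at hbt
    constructor
    · field_simp
      linear_combination I * (J - ξ) * hat - I * (J + ξ) * hbt + 2 * J * u t 0 * I_sq
    · field_simp
      linear_combination hat + hbt
  · rintro ⟨a, b, h⟩ t ht
    have hnhds : ∀ᶠ s in nhds t, 0 < s := lt_mem_nhds ht
    have hp := hasDerivAt_cexp_const_mul J t
    have hm := hasDerivAt_cexp_const_mul (-J) t
    have h0 := ((hp.const_mul (I * (J - ξ) * a)).sub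
      (hm.const_mul (I * (J + ξ) * b))).congr_of_eventuallyEq
        (f₁ := fun s => u s 0) (hnhds.mono fun s hs => (h s hs).1)
    have h1 := ((hp.const_mul a).add (hm.const_mul b)).congr_of_eventuallyEq
        (f₁ := fun s => u s 1) (hnhds.mono fun s hs => (h s hs).2)
    rw [h0.deriv, h1.deriv, (h t ht).1, (h t ht).2]
    constructor
    · linear_combination
        (-(J - ξ) * a * exp (J * t) + (J + ξ) * b * exp (-J * t)) * I_sq
    · linear_combination I * (a * exp (J * t) + b * exp (-J * t)) * hsq
end
end

section
/- Let γ ∈ (0,∞) and ξ ∈ ℝ. Set β₁ = γ/(1 + i(⟨ξ⟩ + ξ)γ), β₂ = −1/(1 + i(⟨ξ⟩ + ξ)γ), v_ξ = (−i(⟨ξ⟩ + ξ), 1)ᵀ ∈ ℂ², and α(ξ) = (γ + i(⟨ξ⟩ + ξ))/(1 + iγ(⟨ξ⟩ + ξ)). Then the 2×2 matrix [β₁v_ξ | β₂v_ξ] whose columns are β₁v_ξ and β₂v_ξ satisfies the identity [β₁v_ξ | β₂v_ξ] · [[i, ξ − ⟨ξ⟩], [ξ + ⟨ξ⟩, i]]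 = α(ξ) · [[i, ξ + ⟨ξ⟩], [ξ − ⟨ξ⟩, i]] · σ₁. -/
noncomputable section

open Complex

/-- The first Pauli matrix `σ₁`. -/
def pauli1 : Matrix (Fin 2) (Fin 2) ℂ := !![0, 1; 1, 0]

/-- `β₁ = γ/(1 + i(⟨ξ⟩+ξ)γ)`. -/
def beta1 (γ ξ : ℝ) : ℂ := (γ : ℂ) / (1 + Complex.I * ((jap ξ + ξ : ℝ) : ℂ) * (γ : ℂ))

/-- `β₂ = −1/(1 + i(⟨ξ⟩+ξ)γ)`. -/
def beta2 (γ ξ : ℝ) : ℂ := -1 / (1 + Complex.I * ((jap ξ + ξ : ℝ) : ℂ) * (γ : ℂ))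

/-- The vector `v_ξ = (−i(⟨ξ⟩+ξ), 1)ᵀ`. -/
def vxi (ξ : ℝ) : Fin 2 → ℂ := ![-(Complex.I * ((jap ξ + ξ : ℝ) : ℂ)), 1]

theorem stmt6 (γ : ℝ) (hγ : 0 < γ) (ξ : ℝ) :
    !![beta1 γ ξ * vxi ξ 0, beta2 γ ξ * vxi ξ 0;
       beta1 γ ξ * vxi ξ 1, beta2 γ ξ * vxi ξ 1] *
      !![Complex.I, ((ξ - jap ξ : ℝ) : ℂ); ((ξ + jap ξ : ℝ) : ℂ), Complex.I]
    = alphaFun γ ξ •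
        (!![Complex.I, ((ξ + jap ξ : ℝ) : ℂ); ((ξ - jap ξ : ℝ) : ℂ), Complex.I] * pauli1) := by
  have hst : (jap ξ : ℂ) ^ 2 = (ξ : ℂ) ^ 2 + 1 := by
    have h : jap ξ ^ 2 = ξ ^ 2 + 1 := Real.sq_sqrt (by positivity)
    exact_mod_cast h
  have hI : Complex.I ^ 2 = -1 := Complex.I_sq
  have hD : 1 + Complex.I * (γ : ℂ) * ((jap ξ + ξ : ℝ) : ℂ) =
      1 + Complex.I * ((jap ξ + ξ : ℝ) : ℂ) * (γ : ℂ) := by ring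
  simp only [alphaFun, beta1, beta2, vxi, pauli1, hD, div_eq_mul_inv]
  generalize (1 + Complex.I * ((jap ξ + ξ : ℝ) : ℂ) * (γ : ℂ))⁻¹ = d
  push_cast
  ext i j
  fin_cases i <;> fin_cases j <;> simp [Matrix.mul_apply, Fin.sum_univ_two] <;> grind
end
end

section
/- Let γ ∈ (0,∞), α(ξ) = (γ + i(⟨ξ⟩ + ξ))/(1 + iγ(⟨ξ⟩ + ξ)), and A(ξ) = α(ξ)·[[i⟨ξ⟩⁻¹, ξ⟨ξ⟩⁻¹ + 1], [ξ⟨ξ⟩⁻¹ − 1, i⟨ξ⟩⁻¹]]. For every c ∈ (0,1) there exists a constant C(γ,c) > 0 such that for all S ∈ ℝ and T > 0, setting r = √(S² + T²), the matrix F(S,T) = ∫_ℝ e^{iξS − ⟨ξ⟩T} A(ξ) dξ (whose defining integral converges absolutely since T > 0) satisfies |F(S,T)| ≤ C(γ,c)·r⁻¹·e^{−c·r}, where |M| denotes the maximum of the moduli of the entries of the matrix M. -/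
noncomputable section

open Complex MeasureTheory

/-- The matrix symbol `A(ξ)` of the edge contribution. -/
def Amat (γ ξ : ℝ) : Matrix (Fin 2) (Fin 2) ℂ :=
  alphaFun γ ξ •
    !![Complex.I * (((jap ξ)⁻¹ : ℝ) : ℂ), ((ξ * (jap ξ)⁻¹ + 1 : ℝ) : ℂ);
       ((ξ * (jap ξ)⁻¹ - 1 : ℝ) : ℂ), Complex.I * (((jap ξ)⁻¹ : ℝ) : ℂ)]

open Filter Topology Set

theorem integral_exp_neg_mul_abs {b : ℝ} (hb : 0 < b) :
    ∫ x : ℝ, Real.exp (-(b * |x|)) = 2 / b := by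
  rw [integral_comp_abs (f := fun x => Real.exp (-(b * x)))]
  have h := integral_exp_mul_Ioi (a := -b) (by linarith) 0
  simp only [neg_mul] at h
  rw [h]
  simp
  ring

theorem integrable_exp_neg_mul_abs {b : ℝ} (hb : 0 < b) :
    Integrable fun x : ℝ => Real.exp (-(b * |x|)) := by
  refine .of_integral_ne_zero ?_
  rw [integral_exp_neg_mul_abs hb]
  positivity

theorem integrable_cosh_smul_comp_sinh_iff {E : Type*} [NormedAddCommGroup E] [NormedSpace ℝ E]
    (g : ℝ → E) : Integrable (fun t => Real.cosh t • g (Real.sinh t)) ↔ Integrable g := by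
  have h := integrableOn_image_iff_integrableOn_abs_deriv_smul (s := univ) .univ
    (fun x _ => (Real.hasDerivAt_sinh x).hasDerivWithinAt) Real.sinh_injective.injOn g
  rw [image_univ, Real.sinh_surjective.range_eq] at h
  simpa [abs_of_pos (Real.cosh_pos _)] using h.symm

theorem integral_cosh_smul_comp_sinh {E : Type*} [NormedAddCommGroup E] [NormedSpace ℝ E]
    (g : ℝ → E) : ∫ t, Real.cosh t • g (Real.sinh t) = ∫ x, g x := by
  have h := integral_image_eq_integral_abs_deriv_smul (s := univ) .univ
    (fun x _ => (Real.hasDerivAt_sinh x).hasDerivWithinAt) Real.sinh_injective.injOn g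
  rw [image_univ, Real.sinh_surjective.range_eq] at h
  simpa [abs_of_pos (Real.cosh_pos _)] using h.symm

theorem abs_sinh_le_cosh (t : ℝ) : |Real.sinh t| ≤ Real.cosh t :=
  abs_le_of_sq_le_sq (by rw [Real.cosh_sq]; linarith) (Real.cosh_pos t).le

theorem integrable_cosh_mul_exp_neg_mul_cosh {a : ℝ} (ha : 0 < a) :
    Integrable fun t => Real.cosh t * Real.exp (-(a * Real.cosh t)) := by
  refine ((integrable_cosh_smul_comp_sinh_iff _).2 (integrable_exp_neg_mul_abs ha)).mono'
    (by fun_prop) (.of_forall fun t => ?_)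
  rw [Real.norm_of_nonneg (by positivity), smul_eq_mul]
  gcongr
  exact abs_sinh_le_cosh t

theorem integral_cosh_mul_exp_neg_mul_cosh_le {a b : ℝ} (hb : 0 < b) (hab : b < a) :
    ∫ t, Real.cosh t * Real.exp (-(a * Real.cosh t)) ≤ 2 / (a - b) * Real.exp (-b) := by
  have hab' : 0 < a - b := sub_pos.2 hab
  calc ∫ t, Real.cosh t * Real.exp (-(a * Real.cosh t))
    _ ≤ ∫ t, (Real.cosh t • Real.exp (-((a - b) * |Real.sinh t|))) * Real.exp (-b) := by
      refine integral_mono (integrable_cosh_mul_exp_neg_mul_cosh (hb.trans hab))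
        (((integrable_cosh_smul_comp_sinh_iff _).2
          (integrable_exp_neg_mul_abs hab')).mul_const _) fun t => ?_
      simp only [smul_eq_mul, mul_assoc, ← Real.exp_add]
      gcongr
      nlinarith [mul_le_mul_of_nonneg_left (abs_sinh_le_cosh t) hab'.le, Real.one_le_cosh t]
    _ = 2 / (a - b) * Real.exp (-b) := by
      rw [integral_mul_const,
        integral_cosh_smul_comp_sinh fun x => Real.exp (-((a - b) * |x|)),
        integral_exp_neg_mul_abs hab']

theorem tendsto_mul_exp_neg_mul_atTop {a : ℝ} (ha : 0 < a) :
    Tendsto (fun x => x * Real.exp (-(a * x))) atTop (𝓝 0) := by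
  have h := ((Real.tendsto_pow_mul_exp_neg_atTop_nhds_zero 1).comp
    (tendsto_id.const_mul_atTop ha)).const_mul a⁻¹
  refine (h.congr fun x => ?_).trans (by simp)
  simp only [Function.comp, pow_one, id]
  field_simp

theorem tendsto_cosh_atTop : Tendsto Real.cosh atTop atTop := by
  refine tendsto_atTop_mono (fun x => ?_) (tendsto_id.atTop_div_const (zero_lt_two' ℝ))
  have := Real.add_one_le_exp x
  have := Real.exp_pos (-x)
  rw [Real.cosh_eq, id]
  linarith

/-- A holomorphic function on a closed horizontal strip with an even integrable majorant that
vanishes at infinity has the same integral along both edges of the strip. -/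
theorem integral_eq_integral_add_mul_I {f : ℂ → ℂ} {φ : ℝ} {B : ℝ → ℝ}
    (hd : DifferentiableOn ℂ f (im ⁻¹' uIcc 0 φ))
    (hB : ∀ z : ℂ, z.im ∈ uIcc 0 φ → ‖f z‖ ≤ B z.re) (heven : ∀ x, B (-x) = B x)
    (hint : Integrable B) (hlim : Tendsto B atTop (𝓝 0)) :
    ∫ x : ℝ, f x = ∫ x : ℝ, f (x + φ * I) := by
  have hline : ∀ y ∈ uIcc 0 φ, Integrable fun x : ℝ => f (x + y * I) := by
    refine fun y hy => hint.mono' (Continuous.aestronglyMeasurable ?_)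
      (.of_forall fun x => by simpa using hB (x + y * I) (by simpa using hy))
    exact hd.continuousOn.comp_continuous (by fun_prop) fun x => by simpa using hy
  have hrect : ∀ R : ℝ, (∫ x : ℝ in -R..R, f x) - (∫ x : ℝ in -R..R, f (x + φ * I)) =
      I * (∫ y : ℝ in 0..φ, f (-R + y * I)) - I * ∫ y : ℝ in 0..φ, f (R + y * I) := by
    intro R
    have h := integral_boundary_rect_eq_zero_of_differentiableOn f ⟨-R, 0⟩ ⟨R, φ⟩
      (hd.mono fun z hz => hz.2)
    simp only [smul_eq_mul, ofReal_zero, zero_mul, add_zero, ofReal_neg] at h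
    linear_combination h
  have hside : ∀ s : ℝ → ℝ, (∀ R, B (s R) = B R) →
      Tendsto (fun R : ℝ => ∫ y : ℝ in 0..φ, f (s R + y * I)) atTop (𝓝 0) := by
    intro s hs
    refine squeeze_zero_norm (a := fun R => B R * |φ - 0|) (fun R => ?_)
      (by simpa using hlim.mul_const |φ - 0|)
    refine intervalIntegral.norm_integral_le_of_norm_le_const fun y hy => ?_
    simpa [hs] using hB (s R + y * I) (by simpa using uIoc_subset_uIcc hy)
  have h0 := intervalIntegral_tendsto_integral (by simpa using hline 0 left_mem_uIcc)
    tendsto_neg_atTop_atBot tendsto_id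
  have h1 := intervalIntegral_tendsto_integral (hline φ right_mem_uIcc)
    tendsto_neg_atTop_atBot tendsto_id
  have hneg := hside (fun R => -R) heven
  have hpos := hside id fun R => rfl
  have h := (hneg.const_mul I).sub (hpos.const_mul I)
  simp only [ofReal_neg, id, mul_zero, sub_zero, ← hrect] at h
  exact sub_eq_zero.1 (tendsto_nhds_unique (h0.sub h1) h)

theorem norm_exp_neg_mul_cosh (r θ : ℝ) (z : ℂ) :
    ‖cexp (-(r * cosh (z - θ * I)))‖ =
      Real.exp (-(r * Real.cos (z.im - θ) * Real.cosh z.re)) := by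
  obtain ⟨x, y⟩ := z
  have : (⟨x, y⟩ : ℂ) - θ * I = x + (y - θ : ℝ) * I := by
    apply Complex.ext <;> simp
  rw [norm_exp, this, cosh_add, cosh_mul_I, sinh_mul_I]
  generalize y - θ = w
  simp [mul_assoc, mul_comm (Real.cos w), cos_ofReal_re]

/-- Shifting the contour of `∫ exp (-r cosh (t - iθ)) g t dt` towards height `θ`, stopping short of
the edge `π/2` by a margin proportional to `δ`. -/
theorem norm_integral_exp_neg_mul_cosh_mul_le {g : ℂ → ℂ} {δ M r θ : ℝ} (hδ : 0 < δ)
    (hδ' : δ < Real.pi / 2) (hd : DifferentiableOn ℂ g {z | |z.im| ≤ Real.pi / 2 - δ})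
    (hg : ∀ z : ℂ, |z.im| ≤ Real.pi / 2 - δ → ‖g z‖ ≤ M * Real.cosh z.re) (hr : 0 < r)
    (hθ : |θ| < Real.pi / 2) :
    Integrable (fun t : ℝ => cexp (-(r * cosh (t - θ * I))) * g t) ∧
      ‖∫ t : ℝ, cexp (-(r * cosh (t - θ * I))) * g t‖ ≤
        M * ∫ t, Real.cosh t * Real.exp (-(r * Real.cos δ * Real.cosh t)) := by
  have hpi := Real.pi_pos
  have hM : 0 ≤ M := by
    have := (norm_nonneg _).trans (hg 0 (by simp; linarith))
    simpa using this
  set q : ℝ := 1 - δ / (Real.pi / 2) with hq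
  have hq0 : 0 < q := by rw [hq, sub_pos, div_lt_one (by positivity)]; exact hδ'
  have hq1 : q < 1 := by rw [hq]; linarith [show 0 < δ / (Real.pi / 2) by positivity]
  have hqpi : q * (Real.pi / 2) = Real.pi / 2 - δ := by rw [hq]; field_simp
  have hstrip : ∀ y ∈ uIcc 0 (q * θ), |y| ≤ Real.pi / 2 - δ ∧ |y - θ| ≤ |θ| := by
    intro y hy
    have hθ1 := abs_lt.1 hθ
    rcases le_total 0 θ with h | h
    · rw [uIcc_of_le (by positivity)] at hy
      rw [abs_of_nonneg hy.1, abs_of_nonneg h, abs_of_nonpos (by nlinarith [hy.2])]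
      constructor <;> nlinarith [hy.1, hy.2]
    · rw [uIcc_of_ge (by nlinarith)] at hy
      rw [abs_of_nonpos hy.2, abs_of_nonpos h, abs_of_nonneg (by nlinarith [hy.1])]
      constructor <;> nlinarith [hy.1, hy.2]
  have hcos : 0 < Real.cos θ := Real.cos_pos_of_mem_Ioo (abs_lt.1 hθ)
  have hmaj : ∀ (z : ℂ) (κ : ℝ), |z.im| ≤ Real.pi / 2 - δ → κ ≤ Real.cos (z.im - θ) →
      ‖cexp (-(r * cosh (z - θ * I))) * g z‖ ≤
        M * (Real.cosh z.re * Real.exp (-(r * κ * Real.cosh z.re))) := by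
    intro z κ hz hκ
    rw [norm_mul, norm_exp_neg_mul_cosh, mul_comm, ← mul_assoc]
    gcongr
    exact hg z hz
  have hcos_le : ∀ y ∈ uIcc 0 (q * θ), Real.cos θ ≤ Real.cos (y - θ) := by
    intro y hy
    rw [← Real.cos_abs θ, ← Real.cos_abs (y - θ)]
    exact Real.cos_le_cos_of_nonneg_of_le_pi (abs_nonneg _) (by linarith) (hstrip y hy).2
  have hdiff : DifferentiableOn ℂ (fun z => cexp (-(r * cosh (z - θ * I))) * g z)
      {z | |z.im| ≤ Real.pi / 2 - δ} :=
    DifferentiableOn.mul (by fun_prop) hd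
  have hshift := integral_eq_integral_add_mul_I (φ := q * θ)
    (B := fun x => M * (Real.cosh x * Real.exp (-(r * Real.cos θ * Real.cosh x))))
    (hdiff.mono fun z hz => (hstrip _ hz).1)
    (fun z hz => hmaj z _ (hstrip _ hz).1 (hcos_le _ hz)) (fun x => by simp)
    ((integrable_cosh_mul_exp_neg_mul_cosh (by positivity)).const_mul M)
    (by simpa using ((tendsto_mul_exp_neg_mul_atTop (mul_pos hr hcos)).comp
      tendsto_cosh_atTop).const_mul M)
  have hcosδ : 0 < Real.cos δ := Real.cos_pos_of_mem_Ioo ⟨by linarith, hδ'⟩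
  constructor
  · refine ((integrable_cosh_mul_exp_neg_mul_cosh (mul_pos hr hcos)).const_mul M).mono'
      (Continuous.aestronglyMeasurable ?_) (.of_forall fun t => ?_)
    · exact hdiff.continuousOn.comp_continuous continuous_ofReal fun t => by
        simpa using hδ'.le
    · simpa using hmaj t (Real.cos θ) (by simpa using hδ'.le) (by simp)
  · rw [hshift, ← integral_const_mul]
    refine norm_integral_le_of_norm_le
      ((integrable_cosh_mul_exp_neg_mul_cosh (mul_pos hr hcosδ)).const_mul M)
      (.of_forall fun t => ?_)
    have hδθ : Real.cos δ ≤ Real.cos (q * θ - θ) := by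
      rw [← Real.cos_abs (q * θ - θ)]
      refine Real.cos_le_cos_of_nonneg_of_le_pi (abs_nonneg _) (by linarith) ?_
      rw [show q * θ - θ = -((1 - q) * θ) by ring, abs_neg, abs_mul, abs_of_pos (by linarith)]
      nlinarith
    simpa using hmaj (t + (q * θ : ℝ) * I) (Real.cos δ)
      (by simpa using (hstrip _ right_mem_uIcc).1) (by simpa using hδθ)

theorem jap_sinh (t : ℝ) : jap (Real.sinh t) = Real.cosh t := by
  rw [jap, ← Real.cosh_sq, Real.sqrt_sq (Real.cosh_pos t).le]

/-- The coefficient `α` in the uniformizing variable `t`, where `ξ = sinh t`. -/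
def alphaStrip (γ : ℝ) (z : ℂ) : ℂ := (γ + I * cexp z) / (1 + I * γ * cexp z)

theorem alphaFun_sinh (γ t : ℝ) : alphaFun γ (Real.sinh t) = alphaStrip γ t := by
  rw [alphaFun, alphaStrip, jap_sinh, Real.cosh_add_sinh, ofReal_exp]

theorem le_normSq_one_add_I_mul {γ δ : ℝ} (hγ : 0 < γ) (hδ : 0 < δ) {z : ℂ}
    (hz : |z.im| ≤ Real.pi / 2 - δ) :
    (1 - Real.cos δ) * (1 + (γ * Real.exp z.re) ^ 2) ≤ normSq (1 + I * γ * cexp z) := by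
  have hpi := Real.pi_pos
  have hz' := abs_le.1 hz
  have hsin : Real.sin z.im ≤ Real.cos δ := by
    rw [← Real.sin_pi_div_two_sub]
    exact Real.sin_le_sin_of_le_of_le_pi_div_two (by linarith) (by linarith) hz'.2
  have heq : normSq (1 + I * γ * cexp z) =
      1 - 2 * (γ * Real.exp z.re) * Real.sin z.im + (γ * Real.exp z.re) ^ 2 := by
    rw [normSq_apply]
    simp [exp_re, exp_im]
    linear_combination (γ * Real.exp z.re) ^ 2 * Real.sin_sq_add_cos_sq z.im
  have hcos : 0 ≤ Real.cos δ :=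
    Real.cos_nonneg_of_neg_pi_div_two_le_of_le (by linarith) (by linarith [abs_nonneg z.im])
  have hu : 0 < γ * Real.exp z.re := by positivity
  rw [heq]
  nlinarith [mul_le_mul_of_nonneg_left hsin hu.le,
    mul_nonneg hcos (sq_nonneg (1 - γ * Real.exp z.re))]

theorem one_add_I_mul_ne_zero_s7 {γ δ : ℝ} (hγ : 0 < γ) (hδ : 0 < δ) {z : ℂ}
    (hz : |z.im| ≤ Real.pi / 2 - δ) : 1 + I * γ * cexp z ≠ 0 := by
  have hcos : Real.cos δ < 1 := by
    rw [← Real.cos_zero]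
    exact Real.cos_lt_cos_of_nonneg_of_le_pi le_rfl
      (by linarith [abs_nonneg z.im, Real.pi_pos]) hδ
  refine normSq_pos.1 (lt_of_lt_of_le ?_ (le_normSq_one_add_I_mul hγ hδ hz))
  have := sub_pos.2 hcos
  positivity

theorem exists_norm_alphaStrip_le {γ δ : ℝ} (hγ : 0 < γ) (hδ : 0 < δ) (hδ' : δ < Real.pi / 2) :
    ∃ M > 0, ∀ z : ℂ, |z.im| ≤ Real.pi / 2 - δ → ‖alphaStrip γ z‖ ≤ M := by
  have hcos : 0 < 1 - Real.cos δ := by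
    rw [sub_pos, ← Real.cos_zero]
    exact Real.cos_lt_cos_of_nonneg_of_le_pi le_rfl (by linarith [Real.pi_pos]) hδ
  refine ⟨√(2 * (γ ^ 2 + (γ ^ 2)⁻¹) / (1 - Real.cos δ)), by positivity, fun z hz => ?_⟩
  refine Real.le_sqrt_of_sq_le ?_
  have hden := le_normSq_one_add_I_mul hγ hδ hz
  have hnum : normSq (γ + I * cexp z) ≤ 2 * (γ ^ 2 + Real.exp z.re ^ 2) := by
    have h : ‖(γ : ℂ) + I * cexp z‖ ≤ γ + Real.exp z.re := by
      refine (norm_add_le _ _).trans_eq ?_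
      simp [norm_exp, abs_of_pos hγ]
    rw [normSq_eq_norm_sq]
    nlinarith [norm_nonneg ((γ : ℂ) + I * cexp z), sq_nonneg (γ - Real.exp z.re)]
  rw [alphaStrip, ← normSq_eq_norm_sq, normSq_div,
    div_le_div_iff₀ (normSq_pos.2 (one_add_I_mul_ne_zero_s7 hγ hδ hz)) hcos]
  calc normSq (γ + I * cexp z) * (1 - Real.cos δ)
    _ ≤ 2 * (γ ^ 2 + Real.exp z.re ^ 2) * (1 - Real.cos δ) := by gcongr
    _ ≤ 2 * (γ ^ 2 + (γ ^ 2)⁻¹) * ((1 - Real.cos δ) * (1 + (γ * Real.exp z.re) ^ 2)) := by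
      have h : (γ ^ 2 + (γ ^ 2)⁻¹) * (1 + (γ * Real.exp z.re) ^ 2) =
          γ ^ 2 + Real.exp z.re ^ 2 + ((γ ^ 2)⁻¹ + γ ^ 4 * Real.exp z.re ^ 2) := by
        field_simp
        ring
      have h' : 0 ≤ (γ ^ 2)⁻¹ + γ ^ 4 * Real.exp z.re ^ 2 := by positivity
      nlinarith [mul_nonneg hcos.le h']
    _ ≤ _ := by gcongr

/-- The entries of `⟨ξ⟩ A(ξ) / α(ξ)` in the uniformizing variable. -/
def stripEntry (j k : Fin 2) (z : ℂ) : ℂ := !![I, cexp z; -cexp (-z), I] j k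

theorem cosh_smul_Amat_sinh (γ t : ℝ) (j k : Fin 2) :
    Real.cosh t • Amat γ (Real.sinh t) j k = alphaStrip γ t * stripEntry j k t := by
  have hc : (Real.cosh t : ℂ) ≠ 0 := ofReal_ne_zero.2 (Real.cosh_pos t).ne'
  have hp : cexp t = cosh t + sinh t := (cosh_add_sinh _).symm
  have hm : cexp (-t) = cosh t - sinh t := (cosh_sub_sinh _).symm
  rw [real_smul]
  fin_cases j <;> fin_cases k <;>
    simp [Amat, stripEntry, alphaFun_sinh, jap_sinh] at hc ⊢ <;>
    field_simp <;> simp only [hp, hm] <;> ring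

theorem differentiable_stripEntry (j k : Fin 2) : Differentiable ℂ (stripEntry j k) := by
  unfold stripEntry
  fin_cases j <;> fin_cases k <;> dsimp <;> fun_prop

theorem norm_stripEntry_le (j k : Fin 2) (z : ℂ) :
    ‖stripEntry j k z‖ ≤ 2 * Real.cosh z.re := by
  have h1 := Real.one_le_cosh z.re
  have h2 := Real.exp_pos z.re
  have h3 := Real.exp_pos (-z.re)
  have h4 := Real.cosh_eq z.re
  fin_cases j <;> fin_cases k <;> simp [stripEntry, norm_exp] <;> linarith

theorem exp_sinh_cosh_eq {S T r θ : ℝ} (hT : r * Real.cos θ = T) (hS : r * Real.sin θ = S)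
    (t : ℝ) :
    cexp (I * (Real.sinh t : ℝ) * S - (Real.cosh t : ℝ) * T) =
      cexp (-(r * cosh (t - θ * I))) := by
  rw [cosh_sub, cosh_mul_I, sinh_mul_I, ← hT, ← hS]
  push_cast
  ring_nf

theorem stmt7 (γ : ℝ) (hγ : 0 < γ) (c : ℝ) (hc : c ∈ Set.Ioo (0 : ℝ) 1) :
    ∃ C > 0, ∀ S T : ℝ, 0 < T → ∀ j k : Fin 2,
      Integrable
        (fun ξ : ℝ =>
          Complex.exp (Complex.I * (ξ : ℂ) * (S : ℂ) - ((jap ξ : ℝ) : ℂ) * (T : ℂ)) *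
            Amat γ ξ j k) ∧
      ‖∫ ξ : ℝ,
          Complex.exp (Complex.I * (ξ : ℂ) * (S : ℂ) - ((jap ξ : ℝ) : ℂ) * (T : ℂ)) *
            Amat γ ξ j k‖
        ≤ C * (Real.sqrt (S ^ 2 + T ^ 2))⁻¹ * Real.exp (-(c * Real.sqrt (S ^ 2 + T ^ 2))) := by
  obtain ⟨hc0, hc1⟩ := hc
  set a : ℝ := (1 + c) / 2 with ha
  set δ := Real.arccos a
  have hδ : 0 < δ := Real.arccos_pos.2 (by linarith)
  have hδ' : δ < Real.pi / 2 := Real.arccos_lt_pi_div_two.2 (by linarith)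
  have hcosδ : Real.cos δ = a := Real.cos_arccos (by linarith) (by linarith)
  obtain ⟨M, hM0, hM⟩ := exists_norm_alphaStrip_le hγ hδ hδ'
  have hac : 0 < a - c := by linarith
  refine ⟨M * 2 * (2 / (a - c)), by positivity, fun S T hT j k => ?_⟩
  set r := √(S ^ 2 + T ^ 2) with hr_def
  have hr : 0 < r := by positivity
  set θ := arg ⟨T, S⟩
  have hnorm : ‖(⟨T, S⟩ : ℂ)‖ = r := by
    rw [norm_def, normSq_mk, hr_def]
    ring_nf
  have hθ : |θ| < Real.pi / 2 := abs_arg_lt_pi_div_two_iff.2 (.inl hT)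
  have hcosθ : r * Real.cos θ = T := hnorm ▸ norm_mul_cos_arg ⟨T, S⟩
  have hsinθ : r * Real.sin θ = S := hnorm ▸ norm_mul_sin_arg ⟨T, S⟩
  have hdiff : DifferentiableOn ℂ (fun z => alphaStrip γ z * stripEntry j k z)
      {z | |z.im| ≤ Real.pi / 2 - δ} :=
    (DifferentiableOn.div (by fun_prop) (by fun_prop)
      fun z hz => one_add_I_mul_ne_zero_s7 hγ hδ hz).mul
        (differentiable_stripEntry j k).differentiableOn
  obtain ⟨hint, hbound⟩ := norm_integral_exp_neg_mul_cosh_mul_le (M := M * 2) hδ hδ' hdiff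
    (fun z hz => by
      rw [norm_mul, mul_assoc]
      exact mul_le_mul (hM z hz) (norm_stripEntry_le j k z) (norm_nonneg _) hM0.le) hr hθ
  have hsubst : (fun t : ℝ => cexp (-(r * cosh (t - θ * I))) *
      (alphaStrip γ t * stripEntry j k t)) = fun t : ℝ => Real.cosh t •
        (cexp (I * (Real.sinh t : ℝ) * S - (jap (Real.sinh t) : ℝ) * T) *
          Amat γ (Real.sinh t) j k) := by
    ext t
    rw [← cosh_smul_Amat_sinh, jap_sinh, exp_sinh_cosh_eq hcosθ hsinθ, mul_smul_comm]
  rw [hsubst] at hint hbound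
  refine ⟨(integrable_cosh_smul_comp_sinh_iff (fun ξ : ℝ =>
    cexp (I * ξ * S - (jap ξ : ℝ) * T) * Amat γ ξ j k)).1 hint, ?_⟩
  rw [integral_cosh_smul_comp_sinh (fun ξ : ℝ =>
    cexp (I * ξ * S - (jap ξ : ℝ) * T) * Amat γ ξ j k), hcosδ] at hbound
  refine hbound.trans ?_
  calc M * 2 * ∫ t, Real.cosh t * Real.exp (-(r * a * Real.cosh t))
    _ ≤ M * 2 * (2 / (r * a - c * r) * Real.exp (-(c * r))) := by
      gcongr
      exact integral_cosh_mul_exp_neg_mul_cosh_le (by positivity) (by nlinarith)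
    _ = M * 2 * (2 / (a - c)) * r⁻¹ * Real.exp (-(c * r)) := by
      rw [show r * a - c * r = (a - c) * r by ring]
      field_simp
end
end

section
/- For every μ₀ > 0 there exists a constant C > 0 such that for all μ ≥ μ₀ and all x, x' ∈ ℝ² with x ≠ x': ∫_{ℝ²} |x − y|⁻¹ · |x' − y|⁻¹ · e^{−μ(|x − y| + |x' − y|)} dy ≤ C·ln(2 + |x − x'|⁻¹). -/
noncomputable section

open MeasureTheory

/-- The one-dimensional profile `(r + d)⁻¹ e^{-mr}` has a logarithmically bounded integral. -/
theorem integrableOn_inv_add_mul_exp_and_integral_le {m d : ℝ} (hm : 0 < m) (hd : 0 < d) :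
    IntegrableOn (fun r : ℝ => (r + d)⁻¹ * Real.exp (-(m * r))) (Set.Ioi 0) ∧
      ∫ r in Set.Ioi (0 : ℝ), (r + d)⁻¹ * Real.exp (-(m * r)) ≤ Real.log (1 + d⁻¹) + m⁻¹ := by
  have hexp : IntegrableOn (fun r : ℝ => Real.exp (-m * r)) (Set.Ioi 0) :=
    integrableOn_exp_mul_Ioi (neg_lt_zero.mpr hm) 0
  have hinv : IntegrableOn (fun r : ℝ => (r + d)⁻¹) (Set.Ioc 0 1) := by
    refine (ContinuousOn.integrableOn_Icc (a := 0) (b := 1) ?_).mono_set Set.Ioc_subset_Icc_self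
    refine ContinuousOn.inv₀ (by fun_prop) fun r hr => ?_
    have := hr.1
    positivity
  have hind : IntegrableOn ((Set.Ioc 0 1).indicator fun r : ℝ => (r + d)⁻¹) (Set.Ioi 0) :=
    ((integrable_indicator_iff measurableSet_Ioc).mpr hinv).integrableOn
  have hle : ∀ r ∈ Set.Ioi (0 : ℝ), (r + d)⁻¹ * Real.exp (-(m * r)) ≤
      (Set.Ioc 0 1).indicator (fun r : ℝ => (r + d)⁻¹) r + Real.exp (-m * r) := by
    intro r hr
    have hr0 : 0 < r := hr
    rw [neg_mul]
    by_cases hr1 : r ≤ 1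
    · rw [Set.indicator_of_mem (Set.mem_Ioc.mpr ⟨hr0, hr1⟩)]
      have h1 : Real.exp (-(m * r)) ≤ 1 := Real.exp_le_one_iff.mpr (by nlinarith)
      have h2 : 0 ≤ (r + d)⁻¹ := by positivity
      nlinarith [Real.exp_pos (-(m * r))]
    · rw [Set.indicator_of_notMem (fun h => hr1 h.2), zero_add]
      exact mul_le_of_le_one_left (Real.exp_pos _).le (inv_le_one_of_one_le₀ (by linarith))
  have hint : IntegrableOn (fun r : ℝ => (r + d)⁻¹ * Real.exp (-(m * r))) (Set.Ioi 0) := by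
    refine (hind.add hexp).mono' (by fun_prop) ?_
    filter_upwards [ae_restrict_mem measurableSet_Ioi] with r hr
    have hr0 : 0 < r := hr
    rw [Real.norm_of_nonneg (by positivity)]
    exact hle r hr
  refine ⟨hint, (setIntegral_mono_on hint (hind.add hexp) measurableSet_Ioi hle).trans_eq ?_⟩
  simp only [Pi.add_apply]
  rw [integral_add hind hexp, integral_exp_mul_Ioi (neg_lt_zero.mpr hm) 0,
    setIntegral_indicator measurableSet_Ioc,
    Set.inter_eq_self_of_subset_right Set.Ioc_subset_Ioi_self,
    ← intervalIntegral.integral_of_le zero_le_one,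
    intervalIntegral.integral_comp_add_right (fun r : ℝ => r⁻¹),
    integral_inv_of_pos (by linarith) (by linarith)]
  congr 1
  · congr 1
    field_simp
    ring
  · simp

/-- The planar radial kernel `|y|⁻¹ (|y| + d)⁻¹ e^{-m|y|}` has a logarithmically bounded
integral. -/
theorem integrable_norm_kernel_and_integral_le {m d : ℝ} (hm : 0 < m) (hd : 0 < d) :
    Integrable (fun y : EuclideanSpace ℝ (Fin 2) =>
        ‖y‖⁻¹ * ((‖y‖ + d)⁻¹ * Real.exp (-(m * ‖y‖)))) ∧
      ∫ y : EuclideanSpace ℝ (Fin 2), ‖y‖⁻¹ * ((‖y‖ + d)⁻¹ * Real.exp (-(m * ‖y‖))) ≤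
        2 * volume.real (Metric.ball (0 : EuclideanSpace ℝ (Fin 2)) 1) *
          (Real.log (1 + d⁻¹) + m⁻¹) := by
  obtain ⟨hint, hle⟩ := integrableOn_inv_add_mul_exp_and_integral_le hm hd
  have hcancel : Set.EqOn
      (fun r : ℝ => r ^ (Module.finrank ℝ (EuclideanSpace ℝ (Fin 2)) - 1) •
        (r⁻¹ * ((r + d)⁻¹ * Real.exp (-(m * r)))))
      (fun r : ℝ => (r + d)⁻¹ * Real.exp (-(m * r))) (Set.Ioi 0) := by
    intro r hr
    have hr0 : r ≠ 0 := (Set.mem_Ioi.mp hr).ne'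
    simp [hr0]
  constructor
  · rw [integrable_fun_norm_addHaar volume
      (f := fun r : ℝ => r⁻¹ * ((r + d)⁻¹ * Real.exp (-(m * r))))]
    exact (integrableOn_congr_fun hcancel measurableSet_Ioi).mpr hint
  · rw [integral_fun_norm_addHaar volume
      (fun r : ℝ => r⁻¹ * ((r + d)⁻¹ * Real.exp (-(m * r)))),
      setIntegral_congr_fun measurableSet_Ioi hcancel, finrank_euclideanSpace_fin,
      nsmul_eq_mul, smul_eq_mul, ← mul_assoc, Nat.cast_ofNat]
    gcongr

/-- When `a ≤ b` and `d ≤ a + b`, the factor `b⁻¹` is controlled by `3 (a + d)⁻¹`. -/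
theorem inv_mul_inv_mul_exp_le_of_le {m μ a b d : ℝ} (hm : 0 < m) (hμ : m ≤ μ) (ha : 0 ≤ a)
    (hab : a ≤ b) (hd : 0 < d) (hdab : d ≤ a + b) :
    a⁻¹ * b⁻¹ * Real.exp (-(μ * (a + b))) ≤
      3 * (a⁻¹ * ((a + d)⁻¹ * Real.exp (-(m * a)))) := by
  have hb : 0 < b := by linarith
  have hexp : Real.exp (-(μ * (a + b))) ≤ Real.exp (-(m * a)) :=
    Real.exp_le_exp.mpr (by nlinarith)
  have hinv : b⁻¹ ≤ 3 * (a + d)⁻¹ := by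
    rw [← div_eq_mul_inv, inv_eq_one_div, div_le_div_iff₀ hb (by linarith)]
    linarith
  calc a⁻¹ * b⁻¹ * Real.exp (-(μ * (a + b)))
      ≤ a⁻¹ * (3 * (a + d)⁻¹) * Real.exp (-(m * a)) := by gcongr
    _ = _ := by ring

/-- A product of two singular kernels is dominated by a sum of kernels with one singularity. -/
theorem inv_mul_inv_mul_exp_le {m μ a b d : ℝ} (hm : 0 < m) (hμ : m ≤ μ) (ha : 0 ≤ a)
    (hb : 0 ≤ b) (hd : 0 < d) (hdab : d ≤ a + b) :
    a⁻¹ * b⁻¹ * Real.exp (-(μ * (a + b))) ≤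
      3 * (a⁻¹ * ((a + d)⁻¹ * Real.exp (-(m * a)))) +
        3 * (b⁻¹ * ((b + d)⁻¹ * Real.exp (-(m * b)))) := by
  rcases le_total a b with hab | hba
  · exact (inv_mul_inv_mul_exp_le_of_le hm hμ ha hab hd hdab).trans
      (le_add_of_nonneg_right (by positivity))
  · rw [mul_comm a⁻¹ b⁻¹, add_comm a b]
    exact (inv_mul_inv_mul_exp_le_of_le hm hμ hb hba hd (by linarith)).trans
      (le_add_of_nonneg_left (by positivity))

theorem stmt10 (μ₀ : ℝ) (hμ₀ : 0 < μ₀) :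
    ∃ C > 0, ∀ μ : ℝ, μ₀ ≤ μ → ∀ x x' : EuclideanSpace ℝ (Fin 2), x ≠ x' →
      Integrable
        (fun y : EuclideanSpace ℝ (Fin 2) =>
          ‖x - y‖⁻¹ * ‖x' - y‖⁻¹ * Real.exp (-(μ * (‖x - y‖ + ‖x' - y‖)))) ∧
      (∫ y : EuclideanSpace ℝ (Fin 2),
          ‖x - y‖⁻¹ * ‖x' - y‖⁻¹ * Real.exp (-(μ * (‖x - y‖ + ‖x' - y‖))))
        ≤ C * Real.log (2 + ‖x - x'‖⁻¹) := by
  set K := 2 * volume.real (Metric.ball (0 : EuclideanSpace ℝ (Fin 2)) 1)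
  have hK0 : 0 < K := mul_pos two_pos
    (ENNReal.toReal_pos (Metric.measure_ball_pos _ _ one_pos).ne' measure_ball_lt_top.ne)
  refine ⟨6 * K * (1 + 2 * μ₀⁻¹), by positivity, fun μ hμ x x' hxx' => ?_⟩
  set d := ‖x - x'‖
  have hd : 0 < d := norm_pos_iff.mpr (sub_ne_zero.mpr hxx')
  obtain ⟨hker, hker_le⟩ := integrable_norm_kernel_and_integral_le hμ₀ hd
  have hle : ∀ y : EuclideanSpace ℝ (Fin 2),
      ‖x - y‖⁻¹ * ‖x' - y‖⁻¹ * Real.exp (-(μ * (‖x - y‖ + ‖x' - y‖))) ≤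
        3 * (‖x - y‖⁻¹ * ((‖x - y‖ + d)⁻¹ * Real.exp (-(μ₀ * ‖x - y‖)))) +
          3 * (‖x' - y‖⁻¹ * ((‖x' - y‖ + d)⁻¹ * Real.exp (-(μ₀ * ‖x' - y‖)))) := by
    refine fun y => inv_mul_inv_mul_exp_le hμ₀ hμ (norm_nonneg _) (norm_nonneg _) hd ?_
    rw [norm_sub_rev x' y]
    exact norm_sub_le_norm_sub_add_norm_sub x y x'
  have hx := (hker.comp_sub_left x).const_mul 3
  have hx' := (hker.comp_sub_left x').const_mul 3
  have hint : Integrable (fun y : EuclideanSpace ℝ (Fin 2) =>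
      ‖x - y‖⁻¹ * ‖x' - y‖⁻¹ * Real.exp (-(μ * (‖x - y‖ + ‖x' - y‖)))) := by
    refine (hx.add hx').mono' (Measurable.aestronglyMeasurable (by fun_prop)) (.of_forall ?_)
    intro y
    rw [Real.norm_of_nonneg (by positivity)]
    exact hle y
  refine ⟨hint, (integral_mono hint (hx.add hx') hle).trans ?_⟩
  simp only [Pi.add_apply]
  rw [integral_add hx hx', integral_const_mul, integral_const_mul,
    integral_sub_left_eq_self (fun y : EuclideanSpace ℝ (Fin 2) =>
      ‖y‖⁻¹ * ((‖y‖ + d)⁻¹ * Real.exp (-(μ₀ * ‖y‖)))) volume x,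
    integral_sub_left_eq_self (fun y : EuclideanSpace ℝ (Fin 2) =>
      ‖y‖⁻¹ * ((‖y‖ + d)⁻¹ * Real.exp (-(μ₀ * ‖y‖)))) volume x']
  have hd' : 0 < d⁻¹ := inv_pos.mpr hd
  have hlog : Real.log (1 + d⁻¹) ≤ Real.log (2 + d⁻¹) :=
    Real.log_le_log (by positivity) (by linarith)
  have hlog2 : 1 ≤ 2 * Real.log (2 + d⁻¹) := by
    have := Real.log_le_log two_pos (show (2 : ℝ) ≤ 2 + d⁻¹ by linarith)
    linarith [Real.log_two_gt_d9]
  have hsum : Real.log (1 + d⁻¹) + μ₀⁻¹ ≤ (1 + 2 * μ₀⁻¹) * Real.log (2 + d⁻¹) := by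
    nlinarith [inv_pos.mpr hμ₀]
  have := hker_le.trans (mul_le_mul_of_nonneg_left hsum hK0.le)
  linarith
end
end

section
/- For every μ₀ > 0 there exists a constant C > 0 such that for all μ ≥ μ₀ and all x, x' ∈ ℝ²: ∫_{ℝ²} ln(2 + |x − y|⁻¹) · |x' − y|⁻¹ · e^{−μ(|x − y| + |x' − y|)} dy ≤ C. -/
noncomputable section

open MeasureTheory

/-- In the plane, `‖y‖ ^ (-k / 2) * exp (-m * ‖y‖)` is integrable for `k < 4`. -/
lemma integrable_sqrt_inv_norm_pow_mul_exp {m : ℝ} (hm : 0 < m) {k : ℕ} (hk : k < 4) :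
    Integrable (fun y : EuclideanSpace ℝ (Fin 2) =>
      √(‖y‖⁻¹) ^ k * Real.exp (-(m * ‖y‖))) := by
  rw [integrable_fun_norm_addHaar volume (f := fun r : ℝ => √(r⁻¹) ^ k * Real.exp (-(m * r)))]
  have hk' : (k : ℝ) < 4 := by exact_mod_cast hk
  have h := integrableOn_rpow_mul_exp_neg_mul_rpow (p := 1) (s := 1 - k / 2) (b := m)
    (by linarith) one_pos hm
  refine h.congr_fun (fun r hr => ?_) measurableSet_Ioi
  have hr0 : 0 < r := hr
  have hpow : √(r⁻¹) ^ k = r ^ (-((k : ℝ) / 2)) := by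
    rw [Real.sqrt_eq_rpow, ← Real.rpow_natCast, Real.inv_rpow hr0.le, ← Real.rpow_neg hr0.le,
      ← Real.rpow_mul hr0.le]
    congr 1
    ring
  simp only [finrank_euclideanSpace, Fintype.card_fin, smul_eq_mul, hpow, Real.rpow_one]
  rw [sub_eq_add_neg, Real.rpow_add hr0, Real.rpow_one]
  simp [mul_assoc]

lemma log_two_add_sq_le {t : ℝ} (ht : 0 ≤ t) : Real.log (2 + t ^ 2) ≤ 2 * (1 + t) := by
  calc Real.log (2 + t ^ 2) ≤ Real.log ((2 + t) ^ 2) :=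
        Real.log_le_log (by positivity) (by nlinarith)
    _ = 2 * Real.log (2 + t) := by simp
    _ ≤ 2 * (1 + t) := by
        have := Real.log_le_sub_one_of_pos (show 0 < 2 + t by linarith)
        linarith

lemma mul_sq_le_cube_add_cube {t u : ℝ} (ht : 0 ≤ t) (hu : 0 ≤ u) :
    t * u ^ 2 ≤ t ^ 3 + u ^ 3 := by
  rcases le_total t u with h | h
  · nlinarith [mul_le_mul_of_nonneg_right h (sq_nonneg u), pow_nonneg ht 3]
  · nlinarith [mul_le_mul_of_nonneg_left (pow_le_pow_left₀ hu h 2) ht, pow_nonneg hu 3]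

lemma log_mul_inv_mul_exp_le {m μ a b : ℝ} (hm : 0 < m) (hμ : m ≤ μ) (ha : 0 ≤ a)
    (hb : 0 ≤ b) :
    Real.log (2 + a⁻¹) * b⁻¹ * Real.exp (-(μ * (a + b))) ≤
      2 * (√(b⁻¹) ^ 2 * Real.exp (-(m * b)) + √(a⁻¹) ^ 3 * Real.exp (-(m * a)) +
        √(b⁻¹) ^ 3 * Real.exp (-(m * b))) := by
  have hea : Real.exp (-(μ * (a + b))) ≤ Real.exp (-(m * a)) :=
    Real.exp_le_exp.2 (by nlinarith [mul_le_mul_of_nonneg_right hμ (add_nonneg ha hb)])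
  have heb : Real.exp (-(μ * (a + b))) ≤ Real.exp (-(m * b)) :=
    Real.exp_le_exp.2 (by nlinarith [mul_le_mul_of_nonneg_right hμ (add_nonneg ha hb)])
  set t := √(a⁻¹)
  set u := √(b⁻¹)
  have ht : 0 ≤ t := Real.sqrt_nonneg _
  have hu : 0 ≤ u := Real.sqrt_nonneg _
  have hta : a⁻¹ = t ^ 2 := (Real.sq_sqrt (inv_nonneg.2 ha)).symm
  have hub : b⁻¹ = u ^ 2 := (Real.sq_sqrt (inv_nonneg.2 hb)).symm
  rw [hta, hub]
  calc Real.log (2 + t ^ 2) * u ^ 2 * Real.exp (-(μ * (a + b)))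
      ≤ 2 * (1 + t) * u ^ 2 * Real.exp (-(μ * (a + b))) := by
        gcongr
        exact log_two_add_sq_le ht
    _ = 2 * (u ^ 2 + t * u ^ 2) * Real.exp (-(μ * (a + b))) := by ring
    _ ≤ 2 * (u ^ 2 + (t ^ 3 + u ^ 3)) * Real.exp (-(μ * (a + b))) := by
        gcongr
        exact mul_sq_le_cube_add_cube ht hu
    _ = 2 * (u ^ 2 * Real.exp (-(μ * (a + b))) + t ^ 3 * Real.exp (-(μ * (a + b))) +
          u ^ 3 * Real.exp (-(μ * (a + b)))) := by ring
    _ ≤ _ := by gcongr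

theorem stmt13 (μ₀ : ℝ) (hμ₀ : 0 < μ₀) :
    ∃ C > 0, ∀ μ : ℝ, μ₀ ≤ μ → ∀ x x' : EuclideanSpace ℝ (Fin 2),
      Integrable
        (fun y : EuclideanSpace ℝ (Fin 2) =>
          Real.log (2 + ‖x - y‖⁻¹) * ‖x' - y‖⁻¹ *
            Real.exp (-(μ * (‖x - y‖ + ‖x' - y‖)))) ∧
      (∫ y : EuclideanSpace ℝ (Fin 2),
          Real.log (2 + ‖x - y‖⁻¹) * ‖x' - y‖⁻¹ *
            Real.exp (-(μ * (‖x - y‖ + ‖x' - y‖))))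
        ≤ C := by
  let g : ℕ → EuclideanSpace ℝ (Fin 2) → ℝ := fun k y => √(‖y‖⁻¹) ^ k * Real.exp (-(μ₀ * ‖y‖))
  have hg_nonneg (k : ℕ) : 0 ≤ ∫ y, g k y := integral_nonneg fun y => by positivity
  have hg {k : ℕ} (hk : k < 4) (z : EuclideanSpace ℝ (Fin 2)) :
      Integrable fun y => g k (z - y) :=
    (integrable_sqrt_inv_norm_pow_mul_exp hμ₀ hk).comp_sub_left z
  refine ⟨2 * ((∫ y, g 2 y) + (∫ y, g 3 y) + ∫ y, g 3 y) + 1,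
    by linarith [hg_nonneg 2, hg_nonneg 3], fun μ hμ x x' => ?_⟩
  have h2 := hg (k := 2) (by norm_num) x'
  have h3 := hg (k := 3) (by norm_num) x
  have h3' := hg (k := 3) (by norm_num) x'
  have hdom : Integrable fun y => 2 * (g 2 (x' - y) + g 3 (x - y) + g 3 (x' - y)) :=
    ((h2.add h3).add h3').const_mul 2
  have hle (y : EuclideanSpace ℝ (Fin 2)) :
      Real.log (2 + ‖x - y‖⁻¹) * ‖x' - y‖⁻¹ * Real.exp (-(μ * (‖x - y‖ + ‖x' - y‖))) ≤
        2 * (g 2 (x' - y) + g 3 (x - y) + g 3 (x' - y)) :=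
    log_mul_inv_mul_exp_le hμ₀ hμ (norm_nonneg _) (norm_nonneg _)
  have hint : Integrable fun y : EuclideanSpace ℝ (Fin 2) =>
      Real.log (2 + ‖x - y‖⁻¹) * ‖x' - y‖⁻¹ * Real.exp (-(μ * (‖x - y‖ + ‖x' - y‖))) := by
    refine hdom.mono' (Measurable.aestronglyMeasurable (by fun_prop))
      (Filter.Eventually.of_forall fun y => ?_)
    have hlog : 0 ≤ Real.log (2 + ‖x - y‖⁻¹) :=
      Real.log_nonneg (by linarith [inv_nonneg.2 (norm_nonneg (x - y))])
    rw [Real.norm_of_nonneg (by positivity)]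
    exact hle y
  refine ⟨hint, (integral_mono hint hdom hle).trans ?_⟩
  rw [integral_const_mul, integral_add (by exact h2.add h3) h3', integral_add h2 h3,
    integral_sub_left_eq_self (g 2), integral_sub_left_eq_self (g 3),
    integral_sub_left_eq_self (g 3)]
  linarith
end
end

section
/- Let ℝ²₊ = ℝ × (0,∞), c ∈ (0,1), C₀, C₁ > 0, and let W : ℝ²₊ → M₂(ℂ) be measurable with |W(y)| ≤ M_W for a.e. y. Suppose 𝔸, K : ℝ²₊ × ℝ²₊ → M₂(ℂ) are measurable, both continuous on {(x, x') : x ≠ x'}, with |𝔸(x, y)| ≤ C₁·ln(2 + |x − y|⁻¹)·e^{−c|x − y|} and |K(y, x')| ≤ C₀·|y − x'|⁻¹·e^{−c|y − x'|} for all distinct arguments. Then the map (x, x') ↦ ∫_{ℝ²₊} 𝔸(x, y)·W(y)·K(y, x') dy is jointly continuous on all of ℝ²₊ × ℝ²₊, including at diagonal points (x₀, x₀). -/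
noncomputable section

open MeasureTheory

/-- The open upper half-plane `ℝ²₊ = {x : x₂ > 0}` inside `ℝ²`. -/
def halfPlane : Set (EuclideanSpace ℝ (Fin 2)) := {x | 0 < x 1}

open Filter Topology

/-- **Scheffé's lemma**: for nonnegative functions, almost everywhere convergence together with
convergence of the integrals implies convergence in `L¹`. -/
theorem tendsto_integral_abs_sub_of_tendsto_integral {α ι : Type*} {m : MeasurableSpace α}
    {μ : Measure α} {l : Filter ι} [l.IsCountablyGenerated] {G : ι → α → ℝ} {g : α → ℝ}
    (hG : ∀ᶠ i in l, Integrable (G i) μ) (hg : Integrable g μ)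
    (hG_nonneg : ∀ᶠ i in l, ∀ᵐ a ∂μ, 0 ≤ G i a)
    (h_lim : ∀ᵐ a ∂μ, Tendsto (fun i => G i a) l (𝓝 (g a)))
    (h_int : Tendsto (fun i => ∫ a, G i a ∂μ) l (𝓝 (∫ a, g a ∂μ))) :
    Tendsto (fun i => ∫ a, |G i a - g a| ∂μ) l (𝓝 0) := by
  have h_neg : Tendsto (fun i => ∫ a, max (g a - G i a) 0 ∂μ) l (𝓝 (∫ _, (0 : ℝ) ∂μ)) := by
    refine tendsto_integral_filter_of_dominated_convergence (fun a => |g a|) ?_ ?_ hg.abs ?_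
    · filter_upwards [hG] with i hi
      exact (hg.sub hi).pos_part.aestronglyMeasurable
    · filter_upwards [hG_nonneg] with i hi
      filter_upwards [hi] with a ha
      rw [Real.norm_of_nonneg (le_max_right _ _)]
      exact max_le (by linarith [le_abs_self (g a)]) (abs_nonneg _)
    · filter_upwards [h_lim] with a ha
      simpa using (ha.const_sub (g a)).max (tendsto_const_nhds (x := (0 : ℝ)))
  have h_sum := (h_int.sub_const (∫ a, g a ∂μ)).add (h_neg.const_mul 2)
  simp only [sub_self, integral_zero, mul_zero, add_zero] at h_sum
  refine h_sum.congr' ?_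
  filter_upwards [hG] with i hi
  have h_pos : Integrable (fun a => max (g a - G i a) 0) μ := (hg.sub hi).pos_part
  have h_diff : Integrable (fun a => G i a - g a) μ := hi.sub hg
  rw [← integral_sub hi hg, ← integral_const_mul, ← integral_add h_diff (h_pos.const_mul 2)]
  refine integral_congr_ae (ae_of_all _ fun a => ?_)
  beta_reduce
  rcases le_total (g a) (G i a) with h | h
  · rw [max_eq_right (by linarith), abs_of_nonneg (by linarith)]; ring
  · rw [max_eq_left (by linarith), abs_of_nonpos (by linarith)]; ring

/-- The dominated convergence theorem with dominating functions that vary with the index and whose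
integrals converge. -/
theorem tendsto_integral_of_varying_dominated {α ι F : Type*} [NormedAddCommGroup F]
    [NormedSpace ℝ F] {m : MeasurableSpace α} {μ : Measure α} {l : Filter ι}
    [l.IsCountablyGenerated] {f : ι → α → F} {f₀ : α → F} {G : ι → α → ℝ} {g : α → ℝ}
    (hf : ∀ᶠ i in l, AEStronglyMeasurable (f i) μ) (hf₀ : AEStronglyMeasurable f₀ μ)
    (hG : ∀ᶠ i in l, Integrable (G i) μ) (hg : Integrable g μ)
    (h_bound : ∀ᶠ i in l, ∀ᵐ a ∂μ, ‖f i a‖ ≤ G i a) (h_bound₀ : ∀ᵐ a ∂μ, ‖f₀ a‖ ≤ g a)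
    (h_lim : ∀ᵐ a ∂μ, Tendsto (fun i => f i a) l (𝓝 (f₀ a)))
    (hG_lim : ∀ᵐ a ∂μ, Tendsto (fun i => G i a) l (𝓝 (g a)))
    (h_int : Tendsto (fun i => ∫ a, G i a ∂μ) l (𝓝 (∫ a, g a ∂μ))) :
    Tendsto (fun i => ∫ a, f i a ∂μ) l (𝓝 (∫ a, f₀ a ∂μ)) := by
  have h_abs := tendsto_integral_abs_sub_of_tendsto_integral hG hg
    (h_bound.mono fun i hi => hi.mono fun a ha => (norm_nonneg _).trans ha) hG_lim h_int
  have h_min_bound : ∀ i, ∀ᵐ a ∂μ, ‖min ‖f i a - f₀ a‖ (2 * g a)‖ ≤ 2 * g a := fun i => by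
    filter_upwards [h_bound₀] with a ha
    have := (norm_nonneg _).trans ha
    rw [Real.norm_of_nonneg (le_min (norm_nonneg _) (by positivity))]
    exact min_le_right _ _
  have h_min_meas : ∀ᶠ i in l,
      AEStronglyMeasurable (fun a => min ‖f i a - f₀ a‖ (2 * g a)) μ := by
    filter_upwards [hf] with i hi
    exact (hi.sub hf₀).norm.inf (hg.const_mul 2).aestronglyMeasurable
  have h_min : Tendsto (fun i => ∫ a, min ‖f i a - f₀ a‖ (2 * g a) ∂μ) l
      (𝓝 (∫ _, (0 : ℝ) ∂μ)) := by
    refine tendsto_integral_filter_of_dominated_convergence (fun a => 2 * g a) h_min_meas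
      (Eventually.of_forall h_min_bound) (hg.const_mul 2) ?_
    filter_upwards [h_lim, h_bound₀] with a ha hb
    have h := (tendsto_iff_norm_sub_tendsto_zero.1 ha).min
      (tendsto_const_nhds (x := 2 * g a))
    rwa [min_eq_left (by linarith [norm_nonneg (f₀ a)])] at h
  have h_sum := h_min.add h_abs
  simp only [integral_zero, add_zero] at h_sum
  rw [tendsto_iff_norm_sub_tendsto_zero]
  refine squeeze_zero' (Eventually.of_forall fun i => norm_nonneg _) ?_ h_sum
  filter_upwards [hf, hG, h_bound, h_min_meas] with i hfi hGi hbi hmi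
  have hfi' : Integrable (f i) μ := hGi.mono' hfi hbi
  have hf₀' : Integrable f₀ μ := hg.mono' hf₀ h_bound₀
  have hmi' : Integrable (fun a => min ‖f i a - f₀ a‖ (2 * g a)) μ :=
    (hg.const_mul 2).mono' hmi (h_min_bound i)
  have habs : Integrable (fun a => |G i a - g a|) μ := (hGi.sub hg).abs
  rw [← integral_sub hfi' hf₀', ← integral_add hmi' habs]
  refine (norm_integral_le_integral_norm _).trans
    (integral_mono_ae (hfi'.sub hf₀').norm (hmi'.add habs) ?_)
  filter_upwards [hbi, h_bound₀] with a ha hb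
  rcases le_total ‖f i a - f₀ a‖ (2 * g a) with h | h
  · rw [min_eq_left h]
    linarith [abs_nonneg (G i a - g a)]
  · rw [min_eq_right h]
    linarith [norm_sub_le (f i a) (f₀ a), le_abs_self (G i a - g a)]

/-- A radial profile, integrable on the plane, that dominates the `3/2`-th power of
`r⁻¹ e^{-c r}` and, up to a constant, the cube of `ln (2 + r⁻¹) e^{-c r}`. -/
def radialMajorant (c r : ℝ) : ℝ :=
  r ^ (-(3 / 2) : ℝ) * (2 * r + 1) ^ 2 * Real.exp (-(c * r))

theorem radialMajorant_nonneg (c : ℝ) {r : ℝ} (hr : 0 ≤ r) : 0 ≤ radialMajorant c r := by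
  unfold radialMajorant
  positivity

theorem continuousAt_radialMajorant (c : ℝ) {r : ℝ} (hr : 0 < r) :
    ContinuousAt (radialMajorant c) r := by
  unfold radialMajorant
  have := Real.continuousAt_rpow_const r (-(3 / 2)) (Or.inl hr.ne')
  fun_prop

theorem integrable_radialMajorant_norm {c : ℝ} (hc : 0 < c) :
    Integrable fun z : EuclideanSpace ℝ (Fin 2) => radialMajorant c ‖z‖ := by
  rw [integrable_fun_norm_addHaar volume (f := radialMajorant c)]
  have h (s : ℝ) (hs : -1 < s) :=
    integrableOn_rpow_mul_exp_neg_mul_rpow hs one_pos hc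
  have h_sum := (((h (3 / 2) (by norm_num)).const_mul 4).add
    ((h (1 / 2) (by norm_num)).const_mul 4)).add (h (-(1 / 2)) (by norm_num))
  refine IntegrableOn.congr_fun h_sum (fun r (hr : 0 < r) => ?_) measurableSet_Ioi
  have h₁ : r ^ (3 / 2 : ℝ) = r ^ 3 * r ^ (-(3 / 2) : ℝ) := by
    rw [← Real.rpow_natCast, ← Real.rpow_add hr]; norm_num
  have h₂ : r ^ (1 / 2 : ℝ) = r ^ 2 * r ^ (-(3 / 2) : ℝ) := by
    rw [← Real.rpow_natCast, ← Real.rpow_add hr]; norm_num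
  have h₃ : r ^ (-(1 / 2) : ℝ) = r * r ^ (-(3 / 2) : ℝ) := by
    nth_rewrite 2 [← Real.rpow_one r]
    rw [← Real.rpow_add hr]; norm_num
  simp only [Pi.add_apply, radialMajorant, finrank_euclideanSpace, Fintype.card_fin, h₁, h₂, h₃,
    Real.rpow_one, smul_eq_mul, neg_mul]
  norm_num
  ring

theorem mul_le_cube_add_rpow {a b : ℝ} (ha : 0 ≤ a) (hb : 0 ≤ b) :
    a * b ≤ a ^ 3 + b ^ (3 / 2 : ℝ) := by
  have hs : b ^ (3 / 2 : ℝ) = √b ^ 3 := by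
    rw [Real.sqrt_eq_rpow, ← Real.rpow_natCast, ← Real.rpow_mul hb]; norm_num
  rw [hs]
  obtain ⟨t, ht, rfl⟩ : ∃ t, 0 ≤ t ∧ b = t ^ 2 := ⟨√b, Real.sqrt_nonneg b, (Real.sq_sqrt hb).symm⟩
  rw [Real.sqrt_sq ht]
  rcases le_total a t with h | h
  · nlinarith [mul_le_mul_of_nonneg_right h (sq_nonneg t), pow_nonneg ha 3]
  · nlinarith [mul_le_mul_of_nonneg_left (pow_le_pow_left₀ ht h 2) ha, pow_nonneg ht 3]

theorem log_mul_exp_cube_le {c r : ℝ} (hc : 0 < c) (hr : 0 < r) :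
    (Real.log (2 + r⁻¹) * Real.exp (-(c * r))) ^ 3 ≤ 8 * radialMajorant c r := by
  have hri : 0 < r⁻¹ := inv_pos.2 hr
  have h_log : Real.log (2 + r⁻¹) ≤ 2 * (2 + r⁻¹) ^ (1 / 2 : ℝ) := by
    have := Real.log_le_rpow_div (x := 2 + r⁻¹) (by positivity) (ε := 1 / 2) (by norm_num)
    linarith
  have h_log0 : 0 ≤ Real.log (2 + r⁻¹) := Real.log_nonneg (by linarith)
  have h_cube : ((2 + r⁻¹) ^ (1 / 2 : ℝ)) ^ 3 ≤ r ^ (-(3 / 2) : ℝ) * (2 * r + 1) ^ 2 := by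
    rw [← Real.rpow_natCast, ← Real.rpow_mul (by positivity),
      show 2 + r⁻¹ = r⁻¹ * (2 * r + 1) by field_simp,
      Real.mul_rpow hri.le (by positivity), Real.inv_rpow hr.le, Real.rpow_neg hr.le]
    norm_num
    gcongr
    rw [← Real.rpow_natCast]
    exact Real.rpow_le_rpow_of_exponent_le (by linarith) (by norm_num)
  have h_exp : Real.exp (-(c * r)) ^ 3 ≤ Real.exp (-(c * r)) :=
    pow_le_of_le_one (Real.exp_pos _).le
      (Real.exp_le_one_iff.2 (by nlinarith [mul_pos hc hr])) (by norm_num)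
  calc (Real.log (2 + r⁻¹) * Real.exp (-(c * r))) ^ 3
      = Real.log (2 + r⁻¹) ^ 3 * Real.exp (-(c * r)) ^ 3 := mul_pow _ _ _
    _ ≤ (2 * (2 + r⁻¹) ^ (1 / 2 : ℝ)) ^ 3 * Real.exp (-(c * r)) := by gcongr
    _ = 8 * (((2 + r⁻¹) ^ (1 / 2 : ℝ)) ^ 3 * Real.exp (-(c * r))) := by ring
    _ ≤ 8 * radialMajorant c r := by unfold radialMajorant; gcongr

theorem inv_mul_exp_rpow_le {c r : ℝ} (hc : 0 < c) (hr : 0 < r) :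
    (r⁻¹ * Real.exp (-(c * r))) ^ (3 / 2 : ℝ) ≤ radialMajorant c r := by
  rw [Real.mul_rpow (by positivity) (by positivity), Real.inv_rpow hr.le, ← Real.rpow_neg hr.le,
    ← Real.exp_mul]
  unfold radialMajorant
  have h_one : (1 : ℝ) ≤ (2 * r + 1) ^ 2 := one_le_pow₀ (by linarith)
  have h_rpow : 0 ≤ r ^ (-(3 / 2) : ℝ) := by positivity
  have h_exp : Real.exp (-(c * r) * (3 / 2)) ≤ Real.exp (-(c * r)) :=
    Real.exp_le_exp.2 (by nlinarith [mul_pos hc hr])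
  exact mul_le_mul (le_mul_of_one_le_right h_rpow h_one) h_exp (Real.exp_pos _).le (by positivity)

theorem log_mul_inv_le_radialMajorant_add {c r s : ℝ} (hc : 0 < c) (hr : 0 < r) (hs : 0 < s) :
    (Real.log (2 + r⁻¹) * Real.exp (-(c * r))) * (s⁻¹ * Real.exp (-(c * s))) ≤
      8 * (radialMajorant c r + radialMajorant c s) := by
  have hri : 0 < r⁻¹ := inv_pos.2 hr
  have h_log0 : 0 ≤ Real.log (2 + r⁻¹) := Real.log_nonneg (by linarith)
  have h := mul_le_cube_add_rpow (a := Real.log (2 + r⁻¹) * Real.exp (-(c * r)))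
    (b := s⁻¹ * Real.exp (-(c * s))) (by positivity) (by positivity)
  linarith [log_mul_exp_cube_le hc hr, inv_mul_exp_rpow_le hc hs,
    radialMajorant_nonneg c hs.le]

theorem norm_mul_mul_apply_le {n : Type*} [Fintype n] {A W K : Matrix n n ℂ} {a w k : ℝ}
    (hA : ∀ i j, ‖A i j‖ ≤ a) (hW : ∀ i j, ‖W i j‖ ≤ w) (hK : ∀ i j, ‖K i j‖ ≤ k) (i j : n) :
    ‖(A * W * K) i j‖ ≤ (Fintype.card n) ^ 2 * (a * w * k) := by
  have ha := (norm_nonneg _).trans (hA i j)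
  have hw := (norm_nonneg _).trans (hW i j)
  simp only [Matrix.mul_apply, Finset.sum_mul]
  calc ‖∑ p, ∑ q, A i q * W q p * K p j‖
      ≤ ∑ _p : n, ∑ _q : n, a * w * k :=
        norm_sum_le_of_le _ fun p _ => norm_sum_le_of_le _ fun q _ => by
          rw [norm_mul, norm_mul]
          gcongr
          exacts [hA i q, hW q p, hK p j]
    _ = (Fintype.card n) ^ 2 * (a * w * k) := by simp; ring

theorem measurableSet_halfPlane : MeasurableSet halfPlane :=
  measurableSet_lt measurable_const (by fun_prop)

theorem stmt15 (c C₀ C₁ M_W : ℝ) (hc : c ∈ Set.Ioo (0 : ℝ) 1)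
    (hC₀ : 0 < C₀) (hC₁ : 0 < C₁)
    (W : EuclideanSpace ℝ (Fin 2) → Matrix (Fin 2) (Fin 2) ℂ)
    (hWm : ∀ j k : Fin 2, Measurable fun y => W y j k)
    (hW : ∀ᵐ y ∂(volume.restrict halfPlane), ∀ j k : Fin 2, ‖W y j k‖ ≤ M_W)
    (A K : EuclideanSpace ℝ (Fin 2) → EuclideanSpace ℝ (Fin 2) → Matrix (Fin 2) (Fin 2) ℂ)
    (hAm : ∀ j k : Fin 2,
      Measurable fun p : EuclideanSpace ℝ (Fin 2) × EuclideanSpace ℝ (Fin 2) =>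
        A p.1 p.2 j k)
    (hKm : ∀ j k : Fin 2,
      Measurable fun p : EuclideanSpace ℝ (Fin 2) × EuclideanSpace ℝ (Fin 2) =>
        K p.1 p.2 j k)
    (hAc : ∀ j k : Fin 2,
      ContinuousOn
        (fun p : EuclideanSpace ℝ (Fin 2) × EuclideanSpace ℝ (Fin 2) => A p.1 p.2 j k)
        ((halfPlane ×ˢ halfPlane) ∩ {p | p.1 ≠ p.2}))
    (hKc : ∀ j k : Fin 2,
      ContinuousOn
        (fun p : EuclideanSpace ℝ (Fin 2) × EuclideanSpace ℝ (Fin 2) => K p.1 p.2 j k)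
        ((halfPlane ×ˢ halfPlane) ∩ {p | p.1 ≠ p.2}))
    (hA : ∀ x ∈ halfPlane, ∀ y ∈ halfPlane, x ≠ y → ∀ j k : Fin 2,
      ‖A x y j k‖ ≤ C₁ * Real.log (2 + ‖x - y‖⁻¹) * Real.exp (-(c * ‖x - y‖)))
    (hK : ∀ y ∈ halfPlane, ∀ x' ∈ halfPlane, y ≠ x' → ∀ j k : Fin 2,
      ‖K y x' j k‖ ≤ C₀ * ‖y - x'‖⁻¹ * Real.exp (-(c * ‖y - x'‖))) :
    ∀ j k : Fin 2,
      ContinuousOn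
        (fun p : EuclideanSpace ℝ (Fin 2) × EuclideanSpace ℝ (Fin 2) =>
          ∫ y in halfPlane, (A p.1 y * W y * K y p.2) j k)
        (halfPlane ×ˢ halfPlane) := by
  intro j k p₀ hp₀
  have hc0 : 0 < c := hc.1
  set C : ℝ := 4 * (C₁ * |M_W| * C₀) * 8 with hC_def
  have hC : 0 ≤ C := by positivity
  let E := EuclideanSpace ℝ (Fin 2)
  let f : E × E → E → ℂ :=
    fun p => halfPlane.indicator fun y => (A p.1 y * W y * K y p.2) j k
  let G : E × E → E → ℝ := fun p y =>
    C * (radialMajorant c ‖p.1 - y‖ + radialMajorant c ‖p.2 - y‖)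
  have hW' : ∀ᵐ y, y ∈ halfPlane → ∀ j k : Fin 2, ‖W y j k‖ ≤ M_W :=
    (ae_restrict_iff' measurableSet_halfPlane).1 hW
  have h_shift (x : E) : Integrable fun y => radialMajorant c ‖x - y‖ :=
    (integrable_radialMajorant_norm hc0).comp_sub_left x
  have hG (p : E × E) : Integrable (G p) := ((h_shift p.1).add (h_shift p.2)).const_mul C
  have hG_int (p : E × E) :
      ∫ y, G p y = C * (2 * ∫ z : E, radialMajorant c ‖z‖) := by
    simp only [G]
    rw [integral_const_mul, integral_add (h_shift p.1) (h_shift p.2),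
      integral_sub_left_eq_self (fun z : E => radialMajorant c ‖z‖),
      integral_sub_left_eq_self (fun z : E => radialMajorant c ‖z‖), two_mul]
  have hf_meas (p : E × E) : AEStronglyMeasurable (f p) := by
    refine (Measurable.indicator ?_ measurableSet_halfPlane).aestronglyMeasurable
    simp only [Matrix.mul_apply]
    have hA' (i l : Fin 2) : Measurable fun y => A p.1 y i l :=
      (hAm i l).comp measurable_prodMk_left
    have hK' (i l : Fin 2) : Measurable fun y => K y p.2 i l :=
      (hKm i l).comp measurable_prodMk_right
    fun_prop
  have h_bound (p : E × E) (hp : p ∈ halfPlane ×ˢ halfPlane) :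
      ∀ᵐ y, ‖f p y‖ ≤ G p y := by
    filter_upwards [hW', volume.ae_ne p.1, volume.ae_ne p.2] with y hWy hy₁ hy₂
    have hG0 : 0 ≤ G p y := mul_nonneg hC (add_nonneg
      (radialMajorant_nonneg c (norm_nonneg _)) (radialMajorant_nonneg c (norm_nonneg _)))
    by_cases hy : y ∈ halfPlane
    · simp only [f, Set.indicator_of_mem hy]
      have hr : 0 < ‖p.1 - y‖ := norm_pos_iff.2 (sub_ne_zero.2 hy₁.symm)
      have hs : 0 < ‖p.2 - y‖ := norm_pos_iff.2 (sub_ne_zero.2 hy₂.symm)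
      refine (norm_mul_mul_apply_le (hA p.1 hp.1 y hy hy₁.symm)
        (fun i l => (hWy hy i l).trans (le_abs_self M_W)) (hK y hy p.2 hp.2 hy₂) j k).trans ?_
      rw [norm_sub_rev y p.2]
      have h := mul_le_mul_of_nonneg_left (log_mul_inv_le_radialMajorant_add hc0 hr hs)
        (show 0 ≤ 4 * (C₁ * |M_W| * C₀) by positivity)
      simp only [Fintype.card_fin]
      refine (le_of_eq ?_).trans (h.trans (le_of_eq ?_))
      · push_cast; ring
      · simp only [G, hC_def]; ring
    · simpa only [f, Set.indicator_of_notMem hy, norm_zero] using hG0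
  have h_ne₁ (y : E) (hy : y ≠ p₀.1) : ∀ᶠ p in 𝓝[halfPlane ×ˢ halfPlane] p₀, p.1 ≠ y :=
    (continuous_fst.continuousAt.eventually_ne hy.symm).filter_mono nhdsWithin_le_nhds
  have h_ne₂ (y : E) (hy : y ≠ p₀.2) : ∀ᶠ p in 𝓝[halfPlane ×ˢ halfPlane] p₀, p.2 ≠ y :=
    (continuous_snd.continuousAt.eventually_ne hy.symm).filter_mono nhdsWithin_le_nhds
  have h_lim : ∀ᵐ y, Tendsto (fun p => f p y) (𝓝[halfPlane ×ˢ halfPlane] p₀) (𝓝 (f p₀ y)) := by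
    filter_upwards [volume.ae_ne p₀.1, volume.ae_ne p₀.2] with y hy₁ hy₂
    by_cases hy : y ∈ halfPlane
    · simp only [f, Set.indicator_of_mem hy, Matrix.mul_apply]
      have hA' (i l : Fin 2) : Tendsto (fun p : E × E => A p.1 y i l)
          (𝓝[halfPlane ×ˢ halfPlane] p₀) (𝓝 (A p₀.1 y i l)) := by
        refine Tendsto.comp (f := fun p : E × E => (p.1, y))
          (hAc i l (p₀.1, y) ⟨⟨hp₀.1, hy⟩, hy₁.symm⟩) (tendsto_nhdsWithin_iff.2 ⟨?_, ?_⟩)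
        · exact (Continuous.tendsto (f := fun p : E × E => (p.1, y)) (by fun_prop) p₀).mono_left
            nhdsWithin_le_nhds
        · filter_upwards [self_mem_nhdsWithin, h_ne₁ y hy₁] with p hp hpy
          exact ⟨⟨hp.1, hy⟩, hpy⟩
      have hK' (i l : Fin 2) : Tendsto (fun p : E × E => K y p.2 i l)
          (𝓝[halfPlane ×ˢ halfPlane] p₀) (𝓝 (K y p₀.2 i l)) := by
        refine Tendsto.comp (f := fun p : E × E => (y, p.2))
          (hKc i l (y, p₀.2) ⟨⟨hy, hp₀.2⟩, hy₂⟩) (tendsto_nhdsWithin_iff.2 ⟨?_, ?_⟩)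
        · exact (Continuous.tendsto (f := fun p : E × E => (y, p.2)) (by fun_prop) p₀).mono_left
            nhdsWithin_le_nhds
        · filter_upwards [self_mem_nhdsWithin, h_ne₂ y hy₂] with p hp hpy
          exact ⟨⟨hy, hp.2⟩, hpy.symm⟩
      exact tendsto_finsetSum _ fun i _ =>
        (tendsto_finsetSum _ fun l _ => (hA' j l).mul_const _).mul (hK' i k)
    · simpa only [f, Set.indicator_of_notMem hy] using tendsto_const_nhds
  have hG_lim : ∀ᵐ y, Tendsto (fun p => G p y) (𝓝[halfPlane ×ˢ halfPlane] p₀) (𝓝 (G p₀ y)) := by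
    filter_upwards [volume.ae_ne p₀.1, volume.ae_ne p₀.2] with y hy₁ hy₂
    have h₁ : ContinuousAt (fun p : E × E => radialMajorant c ‖p.1 - y‖) p₀ :=
      ContinuousAt.comp (f := fun p : E × E => ‖p.1 - y‖)
        (continuousAt_radialMajorant c (norm_pos_iff.2 (sub_ne_zero.2 hy₁.symm))) (by fun_prop)
    have h₂ : ContinuousAt (fun p : E × E => radialMajorant c ‖p.2 - y‖) p₀ :=
      ContinuousAt.comp (f := fun p : E × E => ‖p.2 - y‖)
        (continuousAt_radialMajorant c (norm_pos_iff.2 (sub_ne_zero.2 hy₂.symm))) (by fun_prop)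
    exact ((h₁.add h₂).const_mul C).mono_left nhdsWithin_le_nhds
  have h_main : Tendsto (fun p => ∫ y, f p y) (𝓝[halfPlane ×ˢ halfPlane] p₀)
      (𝓝 (∫ y, f p₀ y)) :=
    tendsto_integral_of_varying_dominated (Eventually.of_forall hf_meas) (hf_meas p₀)
      (Eventually.of_forall hG) (hG p₀) (eventually_nhdsWithin_of_forall h_bound)
      (h_bound p₀ hp₀) h_lim hG_lim (by simp only [hG_int]; exact tendsto_const_nhds)
  have h_ind (p : E × E) :
      ∫ y, f p y = ∫ y in halfPlane, (A p.1 y * W y * K y p.2) j k :=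
    integral_indicator measurableSet_halfPlane
  simp only [h_ind] at h_main
  exact h_main
end
end
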